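/- arXiv:0704.2713 — 2 statements merged into one kernel-verified Lean document; each statement's English description precedes it below -/
import Mathlib

section
/- Let q > 2 and 1 ≤ l < q−1, and let C_{l,q} be the union of the complexes L₁, …, L_q, where L_m is the join of the vertex (i, m) with the complex ([q−1])^{*l} obtained by deleting column m from the l rows j₁, …, j_l. Then C_{l,q} is (l−1)-connected. -/
open Metric

/-- A space `X` is `k`-connected (for an integer `k ≥ -1`) if it is nonempty and
every continuous map `S^l → X` extends to a continuous map `B^{l+1} → X` for all
`0 ≤ l ≤ k`; `(-1)`-connected just means nonempty. -/
def IsKConnected (X : Type*) [TopologicalSpace X] (k : ℤ) : Prop :=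
  (-1 ≤ k → Nonempty X) ∧
  ∀ l : ℕ, (l : ℤ) ≤ k →
    ∀ f : C(sphere (0 : EuclideanSpace ℝ (Fin (l + 1))) 1, X),
      ∃ g : C(closedBall (0 : EuclideanSpace ℝ (Fin (l + 1))) 1, X),
        ∀ x : sphere (0 : EuclideanSpace ℝ (Fin (l + 1))) 1,
          g ⟨x.1, sphere_subset_closedBall x.2⟩ = f x

/-- The geometric realization of the complex C_{l,q}: rows indexed by
Fin (l+1) (row 0 playing the role of the distinguished row i, rows 1,…,l the
rows j₁,…,j_l), each row having q vertices.  Faces use at most one vertex per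
row and contain no vertical edge at row 0, i.e. no face contains both (0, m)
and (s, m) for s ≠ 0. -/
def CRealization (l q : ℕ) : Set ((Fin (l + 1) × Fin q) → ℝ) :=
  {w | (∀ v, 0 ≤ w v) ∧ (∑ v, w v = 1) ∧
    (∀ p r : Fin (l + 1) × Fin q, w p ≠ 0 → w r ≠ 0 → p.1 = r.1 → p = r) ∧
    (∀ s : Fin (l + 1), ∀ m : Fin q, w (0, m) ≠ 0 → s ≠ 0 → w (s, m) = 0)}


namespace CLQ

/-- Cone points over the complex, minus the apex. -/
def Good {l q : ℕ} (w : Fin (l + 1) × Fin q → ℝ) : Prop :=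
  (∀ v, 0 ≤ w v) ∧ (∀ s i j, w (s, i) ≠ 0 → w (s, j) ≠ 0 → i = j) ∧
    (∀ s : Fin (l + 1), ∀ m : Fin q, w (0, m) ≠ 0 → s ≠ 0 → w (s, m) = 0) ∧ ∃ v, w v ≠ 0

/-- No top dimensional simplex on which all coordinates are equal. -/
def NotBary {l q : ℕ} (w : Fin (l + 1) × Fin q → ℝ) : Prop :=
  ∀ (σ : Fin (l + 1) → Fin q) (ρ : ℝ), 0 < ρ → ¬ ∀ s, w (s, σ s) = ρ

noncomputable def flow {l q : ℕ} (c : Fin q) (ρ : ℝ) (w : Fin (l + 1) × Fin q → ℝ) :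
    Fin (l + 1) × Fin q → ℝ := fun v =>
  if v.1 = 0 then w v else
    if v.2 = c then w v + max (ρ - ∑ j ∈ Finset.univ.erase c, w (v.1, j)) 0
    else max (w v - ρ) 0

noncomputable def stageA {l q : ℕ} (c : Fin q) (r : ℝ) (w : Fin (l + 1) × Fin q → ℝ) :
    Fin (l + 1) × Fin q → ℝ := fun v =>
  if v.1 = 0 then (if v.2 = c then w v else (1 - r) * w v)
    else flow c (r * ∑ j ∈ Finset.univ.erase c, w (0, j)) w v

variable {l q : ℕ}

lemma sum_erase_eq {w : Fin (l + 1) × Fin q → ℝ} (hw : Good w) {c j : Fin q} {s : Fin (l + 1)}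
    (hj : j ≠ c) (h : w (s, j) ≠ 0) : ∑ k ∈ Finset.univ.erase c, w (s, k) = w (s, j) := by
  apply Finset.sum_eq_single j
  · intro b _ hb
    by_contra h'
    exact hb (hw.2.1 s b j h' h)
  · intro h'
    simp [hj] at h'

lemma sum_erase_nonneg {w : Fin (l + 1) × Fin q → ℝ} (hw : Good w) (c : Fin q)
    (s : Fin (l + 1)) : 0 ≤ ∑ k ∈ Finset.univ.erase c, w (s, k) :=
  Finset.sum_nonneg fun _ _ => hw.1 _

lemma flow_nonneg {w : Fin (l + 1) × Fin q → ℝ} (hw : Good w) (c : Fin q) (ρ : ℝ)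
    (v : Fin (l + 1) × Fin q) : 0 ≤ flow c ρ w v := by
  have := hw.1 v
  unfold flow
  split_ifs
  · exact this
  · positivity
  · exact le_max_right _ _

lemma flow_zero {w : Fin (l + 1) × Fin q → ℝ} (hw : Good w) (c : Fin q) :
    flow c 0 w = w := by
  ext v
  unfold flow
  split_ifs
  · rfl
  · rw [max_eq_right]
    · simp
    · linarith [sum_erase_nonneg hw c v.1]
  · simpa using hw.1 v

lemma flow_row {w : Fin (l + 1) × Fin q → ℝ} (hw : Good w) (c : Fin q) {ρ : ℝ} (hρ : 0 ≤ ρ)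
    {s : Fin (l + 1)} {i : Fin q} (hi : i ≠ c) (hs : s ≠ 0)
    (h : flow c ρ w (s, i) ≠ 0) : ρ < w (s, i) ∧ flow c ρ w (s, c) = 0 := by
  simp only [flow, hs, hi, if_false, if_true] at h ⊢
  have h1 : ρ < w (s, i) := by
    by_contra h'
    exact h (max_eq_right (by linarith))
  have h2 : w (s, i) ≠ 0 := by linarith
  refine ⟨h1, ?_⟩
  rw [sum_erase_eq hw hi h2, max_eq_right (by linarith), add_zero]
  by_contra h3
  exact hi (hw.2.1 s i c h2 h3)

lemma flow_row_unique {w : Fin (l + 1) × Fin q → ℝ} (hw : Good w) (c : Fin q) {ρ : ℝ}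
    (hρ : 0 ≤ ρ) (s : Fin (l + 1)) (i j : Fin q)
    (h : flow c ρ w (s, i) ≠ 0) (h' : flow c ρ w (s, j) ≠ 0) : i = j := by
  by_cases hs : s = 0
  · simp only [flow, hs, if_true] at h h'
    exact hw.2.1 0 i j h h'
  by_cases hi : i = c <;> by_cases hj : j = c
  · rw [hi, hj]
  · subst hi
    exact absurd (flow_row hw i hρ hj hs h').2 h
  · subst hj
    exact absurd (flow_row hw j hρ hi hs h).2 h'
  · have h1 := (flow_row hw c hρ hi hs h).1
    have h2 := (flow_row hw c hρ hj hs h').1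
    exact hw.2.1 s i j (by linarith) (by linarith)

lemma flow_eq_zero {w : Fin (l + 1) × Fin q → ℝ} (c : Fin q) {ρ : ℝ}
    (hρ : 0 ≤ ρ) {s : Fin (l + 1)} {m : Fin q} (hm : m ≠ c) (hs : s ≠ 0)
    (h : w (s, m) = 0) : flow c ρ w (s, m) = 0 := by
  simp only [flow, hs, hm, if_false, h]
  exact max_eq_right (by linarith)

lemma stageA_one {w : Fin (l + 1) × Fin q → ℝ} (c m : Fin q) (hm : m ≠ c) :
    stageA c 1 w (0, m) = 0 := by
  simp [stageA, hm]

lemma stageA_self {w : Fin (l + 1) × Fin q → ℝ} (c : Fin q) (r : ℝ) :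
    stageA c r w (0, c) = w (0, c) := by
  simp [stageA]

lemma stageA_id {w : Fin (l + 1) × Fin q → ℝ} (hw : Good w) (c : Fin q) (r : ℝ)
    (h : ∀ m, m ≠ c → w (0, m) = 0) : stageA c r w = w := by
  have h0 : ∑ j ∈ Finset.univ.erase c, w (0, j) = 0 :=
    Finset.sum_eq_zero fun j hj => h j (Finset.ne_of_mem_erase hj)
  ext ⟨s, i⟩
  simp only [stageA, h0, mul_zero, flow_zero hw]
  split_ifs with h1 h2
  · rfl
  · rw [h1, h i h2, mul_zero]
  · rfl

lemma stageA_zero {w : Fin (l + 1) × Fin q → ℝ} (hw : Good w) (c : Fin q) :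
    stageA c 0 w = w := by
  ext ⟨s, i⟩
  simp [stageA, flow_zero hw]

lemma stageA_good {w : Fin (l + 1) × Fin q → ℝ} (hw : Good w) (hb : NotBary w) (c : Fin q)
    {r : ℝ} (h0 : 0 ≤ r) (h1 : r ≤ 1) : Good (stageA c r w) := by
  by_cases hz : ∀ m, m ≠ c → w (0, m) = 0
  · rw [stageA_id hw c r hz]; exact hw
  push Not at hz
  obtain ⟨m₀, hm₀, hz⟩ := hz
  have hc : w (0, c) = 0 := by
    by_contra h
    exact hm₀ (hw.2.1 0 _ _ hz h)
  have hsum := sum_erase_eq hw hm₀ hz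
  have hpos : 0 < w (0, m₀) := lt_of_le_of_ne (hw.1 _) (Ne.symm hz)
  have hρ : 0 ≤ r * w (0, m₀) := by positivity
  have e0 : ∀ m, stageA c r w (0, m) = (1 - r) * w (0, m) := by
    intro m
    by_cases hm : m = c
    · subst hm; rw [stageA_self, hc, mul_zero]
    · simp [stageA, hm]
  have e1 : ∀ s m, s ≠ 0 → stageA c r w (s, m) = flow c (r * w (0, m₀)) w (s, m) := by
    intro s m hs
    simp [stageA, hs, hsum]
  refine ⟨?_, ?_, ?_, ?_⟩
  · rintro ⟨s, m⟩
    by_cases hs : s = 0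
    · subst hs
      rw [e0]
      exact mul_nonneg (by linarith) (hw.1 _)
    · rw [e1 _ _ hs]
      exact flow_nonneg hw _ _ _
  · intro s i j
    by_cases hs : s = 0
    · subst hs
      rw [e0, e0]
      intro hi hj
      exact hw.2.1 0 i j (right_ne_zero_of_mul hi) (right_ne_zero_of_mul hj)
    · rw [e1 _ _ hs, e1 _ _ hs]
      exact flow_row_unique hw c hρ s i j
  · intro s m hm hs
    rw [e0] at hm
    have hm' := right_ne_zero_of_mul hm
    rw [e1 _ _ hs]
    exact flow_eq_zero c hρ (fun h => hm' (h ▸ hc)) hs (hw.2.2.1 s m hm' hs)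
  · by_contra hcon
    push Not at hcon
    have hr : r = 1 := by
      have := hcon (0, m₀)
      rw [e0] at this
      rcases mul_eq_zero.1 this with h | h
      · linarith
      · exact absurd h hz
    subst hr
    have key : ∀ s : Fin (l + 1), ∃ j, w (s, j) = w (0, m₀) := by
      intro s
      by_cases hs : s = 0
      · subst hs; exact ⟨m₀, rfl⟩
      have hsc := hcon (s, c)
      rw [e1 _ _ hs] at hsc
      simp only [flow, hs, if_false, if_true, one_mul] at hsc
      have a1 := hw.1 (s, c)
      have a2 := le_max_left (w (0, m₀) - ∑ j ∈ Finset.univ.erase c, w (s, j)) 0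
      have a3 : ∑ j ∈ Finset.univ.erase c, w (s, j) ≠ 0 := by
        intro h
        rw [h] at a2 hsc
        linarith
      obtain ⟨j, hj, hj'⟩ := Finset.exists_ne_zero_of_sum_ne_zero a3
      have hjc := Finset.ne_of_mem_erase hj
      rw [sum_erase_eq hw hjc hj'] at a2 hsc
      have hsj := hcon (s, j)
      rw [e1 _ _ hs] at hsj
      simp only [flow, hs, hjc, if_false, one_mul] at hsj
      have a4 := le_max_left (w (s, j) - w (0, m₀)) 0
      exact ⟨j, by linarith⟩
    choose σ hσ using key
    exact hb σ _ hpos hσ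

lemma stageA_notBary {w : Fin (l + 1) × Fin q → ℝ} (hw : Good w) (hb : NotBary w) (c : Fin q) :
    NotBary (stageA c 1 w) := by
  by_cases hz : ∀ m, m ≠ c → w (0, m) = 0
  · rw [stageA_id hw c 1 hz]; exact hb
  push Not at hz
  obtain ⟨m₀, hm₀, hz⟩ := hz
  have hc : w (0, c) = 0 := by
    by_contra h
    exact hm₀ (hw.2.1 0 _ _ hz h)
  intro σ ρ hρ h
  have := h 0
  by_cases hm : σ 0 = c
  · rw [hm, stageA_self, hc] at this; linarith
  · rw [stageA_one _ _ hm] at this; linarith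

/-- Adding an apex in row zero, in a column chosen by `μ`. -/
noncomputable def stageB (c : Fin q) (μ : (Fin l → Fin q) → Fin q) (r : ℝ)
    (w : Fin (l + 1) × Fin q → ℝ) : Fin (l + 1) × Fin q → ℝ := fun v =>
  if v.1 = 0 then w v + r * ∑ σ : Fin l → Fin q,
    (if μ σ = v.2 ∧ ∀ s, σ s ≠ c then ∏ s, w (s.succ, σ s) else 0) else w v

lemma stageB_zero (c : Fin q) (μ : (Fin l → Fin q) → Fin q)
    (w : Fin (l + 1) × Fin q → ℝ) : stageB c μ 0 w = w := by
  ext v; simp [stageB]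

lemma stageB_ne {c : Fin q} {μ : (Fin l → Fin q) → Fin q} {r : ℝ}
    {w : Fin (l + 1) × Fin q → ℝ} (hz : ∀ m, w (0, m) = 0) {m : Fin q}
    (h : stageB c μ r w (0, m) ≠ 0) :
    ∃ σ : Fin l → Fin q, μ σ = m ∧ (∀ s, σ s ≠ c) ∧ ∀ s, w (s.succ, σ s) ≠ 0 := by
  simp only [stageB, if_true, hz, zero_add] at h
  obtain ⟨σ, -, hσ⟩ := Finset.exists_ne_zero_of_sum_ne_zero (right_ne_zero_of_mul h)
  split_ifs at hσ with h'
  · exact ⟨σ, h'.1, h'.2, fun s => Finset.prod_ne_zero_iff.1 hσ s (Finset.mem_univ _)⟩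
  · exact absurd rfl hσ

lemma stageB_nonneg {w : Fin (l + 1) × Fin q → ℝ} (hw : Good w) (c : Fin q)
    (μ : (Fin l → Fin q) → Fin q) {r : ℝ} (hr : 0 ≤ r) (v : Fin (l + 1) × Fin q) :
    w v ≤ stageB c μ r w v := by
  unfold stageB
  split_ifs with h
  · have : 0 ≤ ∑ σ : Fin l → Fin q,
        (if μ σ = v.2 ∧ ∀ s, σ s ≠ c then ∏ s, w (s.succ, σ s) else 0) := by
      apply Finset.sum_nonneg
      intro σ _
      split_ifs
      · exact Finset.prod_nonneg fun _ _ => hw.1 _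
      · exact le_rfl
    have := mul_nonneg hr this
    linarith
  · exact le_rfl

lemma stageB_good {w : Fin (l + 1) × Fin q → ℝ} (hw : Good w) (c : Fin q)
    (μ : (Fin l → Fin q) → Fin q) (hμ : ∀ σ s, μ σ ≠ σ s) (hz : ∀ m, w (0, m) = 0)
    {r : ℝ} (hr : 0 ≤ r) : Good (stageB c μ r w) := by
  have e1 : ∀ s m, s ≠ 0 → stageB c μ r w (s, m) = w (s, m) := by
    intro s m hs; simp [stageB, hs]
  refine ⟨fun v => (hw.1 v).trans (stageB_nonneg hw c μ hr v), ?_, ?_, ?_⟩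
  · intro s i j
    by_cases hs : s = 0
    · subst hs
      intro hi hj
      obtain ⟨σ, h1, -, h2⟩ := stageB_ne hz hi
      obtain ⟨τ, h3, -, h4⟩ := stageB_ne hz hj
      have : σ = τ := funext fun s => hw.2.1 _ _ _ (h2 s) (h4 s)
      rw [← h1, ← h3, this]
    · rw [e1 _ _ hs, e1 _ _ hs]; exact hw.2.1 s i j
  · intro s m hm hs
    obtain ⟨σ, h1, -, h2⟩ := stageB_ne hz hm
    rw [e1 _ _ hs]
    by_contra h
    obtain ⟨s, rfl⟩ := Fin.exists_succ_eq.2 hs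
    exact hμ σ s (h1.trans (hw.2.1 _ _ _ h (h2 s)))
  · obtain ⟨v, hv⟩ := hw.2.2.2
    refine ⟨v, ?_⟩
    have := stageB_nonneg hw c μ hr v
    have := lt_of_le_of_ne (hw.1 v) (Ne.symm hv)
    linarith

lemma stageB_apex {w : Fin (l + 1) × Fin q → ℝ} (c : Fin q)
    (μ : (Fin l → Fin q) → Fin q) (hμ : ∀ σ, μ σ ≠ c) (hz : ∀ m, w (0, m) = 0) (r : ℝ) :
    stageB c μ r w (0, c) = 0 := by
  by_contra h
  obtain ⟨σ, h1, -⟩ := stageB_ne hz h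
  exact hμ σ h1

lemma stageB_prop {w : Fin (l + 1) × Fin q → ℝ} (hw : Good w) (c : Fin q)
    (μ : (Fin l → Fin q) → Fin q) :
    (∃ m, stageB c μ 1 w (0, m) ≠ 0) ∨ ∃ s, s ≠ 0 ∧ ∀ i, i ≠ c → stageB c μ 1 w (s, i) = 0 := by
  by_cases h : ∃ s, s ≠ 0 ∧ ∀ i, i ≠ c → stageB c μ 1 w (s, i) = 0
  · exact Or.inr h
  left
  push Not at h
  have h' : ∀ s : Fin l, ∃ i, i ≠ c ∧ w (s.succ, i) ≠ 0 := by
    intro s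
    obtain ⟨i, hi, h2⟩ := h s.succ (Fin.succ_ne_zero s)
    refine ⟨i, hi, ?_⟩
    simpa [stageB] using h2
  choose σ h1 h2 using h'
  refine ⟨μ σ, ?_⟩
  have h3 : ∀ τ : Fin l → Fin q, 0 ≤
      (if μ τ = μ σ ∧ ∀ s, τ s ≠ c then ∏ s, w (s.succ, τ s) else 0) := by
    intro τ
    split_ifs
    · exact Finset.prod_nonneg fun _ _ => hw.1 _
    · exact le_rfl
  have h4 := Finset.single_le_sum (fun τ _ => h3 τ) (Finset.mem_univ σ)
  rw [if_pos ⟨rfl, h1⟩] at h4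
  have h5 : 0 < ∏ s, w (s.succ, σ s) :=
    Finset.prod_pos fun s _ => lt_of_le_of_ne (hw.1 _) (Ne.symm (h2 s))
  have h6 := hw.1 (0, μ σ)
  simp only [stageB, if_true, one_mul]
  have : 0 < w (0, μ σ) + ∑ τ : Fin l → Fin q,
    (if μ τ = μ σ ∧ ∀ s, τ s ≠ c then ∏ s, w (s.succ, τ s) else 0) := by linarith
  exact this.ne'

lemma flow_good {w : Fin (l + 1) × Fin q → ℝ} (hw : Good w) (c : Fin q) (hc : w (0, c) = 0)
    (h : (∃ m, w (0, m) ≠ 0) ∨ ∃ s, s ≠ 0 ∧ ∀ i, i ≠ c → w (s, i) = 0) {ρ : ℝ} (hρ : 0 ≤ ρ) :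
    Good (flow c ρ w) := by
  refine ⟨flow_nonneg hw c ρ, flow_row_unique hw c hρ, ?_, ?_⟩
  · intro s m hm hs
    simp only [flow, if_true] at hm
    exact flow_eq_zero c hρ (fun h => hm (h ▸ hc)) hs (hw.2.2.1 s m hm hs)
  · rcases hρ.eq_or_lt with rfl | hρ
    · rw [flow_zero hw]; exact hw.2.2.2
    rcases h with ⟨m, hm⟩ | ⟨s, hs, h⟩
    · exact ⟨(0, m), by simpa [flow] using hm⟩
    · refine ⟨(s, c), ?_⟩
      simp only [flow, hs, if_false, if_true]
      rw [Finset.sum_eq_zero fun j hj => h j (Finset.ne_of_mem_erase hj)]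
      have := hw.1 (s, c)
      have := le_max_left (ρ - 0) 0
      linarith

lemma flow_end {w : Fin (l + 1) × Fin q → ℝ} (hw : Good w) (c : Fin q) {s : Fin (l + 1)}
    (hs : s ≠ 0) {i : Fin q} (hi : i ≠ c) : flow c (1 + ∑ v, w v) w (s, i) = 0 := by
  simp only [flow, hs, hi, if_false]
  have := Finset.single_le_sum (fun v _ => hw.1 v) (Finset.mem_univ (s, i))
  exact max_eq_right (by linarith)

lemma linear_good {w e : Fin (l + 1) × Fin q → ℝ} (hw : Good w) (he : Good e)
    (h1 : ∀ s i j, w (s, i) ≠ 0 → e (s, j) ≠ 0 → i = j)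
    (h2 : ∀ s m, s ≠ 0 → w (0, m) ≠ 0 → e (s, m) = 0)
    (h3 : ∀ s m, s ≠ 0 → e (0, m) ≠ 0 → w (s, m) = 0) {r : ℝ} (h0 : 0 ≤ r) (h1' : r ≤ 1) :
    Good (fun v => (1 - r) * w v + r * e v) := by
  have hh : ∀ v, (1 - r) * w v + r * e v ≠ 0 → w v ≠ 0 ∨ e v ≠ 0 := by
    intro v hv
    by_contra hcon
    push Not at hcon
    exact hv (by rw [hcon.1, hcon.2]; ring)
  have hr : 0 ≤ 1 - r := by linarith
  refine ⟨fun v => add_nonneg (mul_nonneg hr (hw.1 v)) (mul_nonneg h0 (he.1 v)), ?_, ?_, ?_⟩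
  · intro s i j hi hj
    rcases hh _ hi with hi | hi <;> rcases hh _ hj with hj | hj
    · exact hw.2.1 s i j hi hj
    · exact h1 s i j hi hj
    · exact (h1 s j i hj hi).symm
    · exact he.2.1 s i j hi hj
  · intro s m hm hs
    show (1 - r) * w (s, m) + r * e (s, m) = 0
    rcases hh _ hm with hm | hm
    · rw [hw.2.2.1 s m hm hs, h2 s m hs hm]; ring
    · rw [he.2.2.1 s m hm hs, h3 s m hs hm]; ring
  · rcases h0.eq_or_lt with rfl | h0
    · obtain ⟨v, hv⟩ := hw.2.2.2
      exact ⟨v, by simpa using hv⟩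
    · obtain ⟨v, hv⟩ := he.2.2.2
      refine ⟨v, ?_⟩
      have a := mul_nonneg hr (hw.1 v)
      have b := mul_pos h0 (lt_of_le_of_ne (he.1 v) (Ne.symm hv))
      show (1 - r) * w v + r * e v ≠ 0
      linarith

/-- Homotopy relation for maps into the set of good points. -/
def Conn {S : Type*} [TopologicalSpace S] (F G : S → Fin (l + 1) × Fin q → ℝ) : Prop :=
  ∃ F' G' : C(S, {w : Fin (l + 1) × Fin q → ℝ // Good w}),
    (∀ x, (F' x).1 = F x) ∧ (∀ x, (G' x).1 = G x) ∧ F'.Homotopic G'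

lemma Conn.trans {S : Type*} [TopologicalSpace S] {F G K : S → Fin (l + 1) × Fin q → ℝ}
    (h : Conn F G) (h' : Conn G K) : Conn F K := by
  obtain ⟨a, b, h1, h2, h3⟩ := h
  obtain ⟨b', c, h4, h5, h6⟩ := h'
  have : b = b' := by
    ext1 x
    exact Subtype.ext ((h2 x).trans (h4 x).symm)
  subst this
  exact ⟨a, c, h1, h5, h3.trans h6⟩

lemma Conn.of_homotopy {S : Type*} [TopologicalSpace S]
    (H : ℝ → S → Fin (l + 1) × Fin q → ℝ) (hc : Continuous fun p : ℝ × S => H p.1 p.2)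
    (hg : ∀ r, 0 ≤ r → r ≤ 1 → ∀ x, Good (H r x)) {F G : S → Fin (l + 1) × Fin q → ℝ}
    (h0 : H 0 = F) (h1 : H 1 = G) : Conn F G := by
  subst h0 h1
  refine ⟨⟨fun x => ⟨H 0 x, hg 0 le_rfl zero_le_one x⟩, ?_⟩,
    ⟨fun x => ⟨H 1 x, hg 1 zero_le_one le_rfl x⟩, ?_⟩, fun _ => rfl, fun _ => rfl, ⟨⟨⟨fun p =>
      ⟨H p.1 p.2, hg _ p.1.2.1 p.1.2.2 _⟩, ?_⟩, ?_, ?_⟩⟩⟩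
  · exact Continuous.subtype_mk (hc.comp (by fun_prop : Continuous fun x : S => ((0 : ℝ), x))) _
  · exact Continuous.subtype_mk (hc.comp (by fun_prop : Continuous fun x : S => ((1 : ℝ), x))) _
  · exact Continuous.subtype_mk
      (hc.comp (by fun_prop : Continuous fun p : unitInterval × S => ((p.1 : ℝ), p.2))) _
  · intro x; simp
  · intro x; simp

lemma flow_continuous {T : Type*} [TopologicalSpace T] (c : Fin q) {ρ : T → ℝ}
    (hρ : Continuous ρ) {W : T → Fin (l + 1) × Fin q → ℝ} (hW : Continuous W) :
    Continuous fun x => flow c (ρ x) (W x) := by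
  apply continuous_pi
  intro v
  unfold flow
  split_ifs <;> fun_prop

lemma stageA_continuous {T : Type*} [TopologicalSpace T] (c : Fin q) {ρ : T → ℝ}
    (hρ : Continuous ρ) {W : T → Fin (l + 1) × Fin q → ℝ} (hW : Continuous W) :
    Continuous fun x => stageA c (ρ x) (W x) := by
  apply continuous_pi
  intro v
  unfold stageA
  split_ifs
  · fun_prop
  · fun_prop
  · exact (continuous_apply v).comp (flow_continuous c (by fun_prop) hW)

lemma stageB_continuous {T : Type*} [TopologicalSpace T] (c : Fin q)
    (μ : (Fin l → Fin q) → Fin q) {ρ : T → ℝ}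
    (hρ : Continuous ρ) {W : T → Fin (l + 1) × Fin q → ℝ} (hW : Continuous W) :
    Continuous fun x => stageB c μ (ρ x) (W x) := by
  apply continuous_pi
  intro v
  unfold stageB
  split_ifs
  · refine Continuous.add (by fun_prop) (hρ.mul (continuous_finsetSum _ fun σ _ => ?_))
    split_ifs <;> fun_prop
  · fun_prop

/-- A generic map contracts. -/
lemma conn_of_notBary {S : Type*} [TopologicalSpace S] (hl : 1 ≤ l) (hlq : l < q - 1)
    (F : S → Fin (l + 1) × Fin q → ℝ) (hF : Continuous F) (hg : ∀ x, Good (F x))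
    (hb : ∀ x, NotBary (F x)) : ∃ e, Conn F (fun _ => e) := by
  let c : Fin q := ⟨0, by omega⟩
  let d : Fin q := ⟨1, by omega⟩
  have hcd : c ≠ d := by simp [c, d]
  have hμ : ∀ σ : Fin l → Fin q, ∃ m, m ≠ c ∧ ∀ s, m ≠ σ s := by
    intro σ
    have : (insert c (Finset.univ.image σ)).card < (Finset.univ : Finset (Fin q)).card := by
      refine (Finset.card_insert_le _ _).trans_lt ?_
      have := Finset.card_image_le (s := Finset.univ) (f := σ)
      simp only [Finset.card_univ, Fintype.card_fin] at this ⊢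
      omega
    obtain ⟨m, -, hm⟩ := Finset.exists_mem_notMem_of_card_lt_card this
    simp only [Finset.mem_insert, Finset.mem_image, Finset.mem_univ, true_and, not_or,
      not_exists] at hm
    exact ⟨m, hm.1, fun s h => hm.2 s h.symm⟩
  choose μ hμc hμ using hμ
  -- stage A twice
  let F1 : S → Fin (l + 1) × Fin q → ℝ := fun x => stageA c 1 (F x)
  have hF1 : Continuous F1 := stageA_continuous c continuous_const hF
  have g1 : ∀ x, Good (F1 x) := fun x => stageA_good (hg x) (hb x) c zero_le_one le_rfl
  have b1 : ∀ x, NotBary (F1 x) := fun x => stageA_notBary (hg x) (hb x) c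
  have C1 : Conn F F1 := Conn.of_homotopy (fun r x => stageA c r (F x))
    (stageA_continuous c continuous_fst (hF.comp continuous_snd))
    (fun r h0 h1 x => stageA_good (hg x) (hb x) c h0 h1)
    (funext fun x => stageA_zero (hg x) c) rfl
  let F2 : S → Fin (l + 1) × Fin q → ℝ := fun x => stageA d 1 (F1 x)
  have hF2 : Continuous F2 := stageA_continuous d continuous_const hF1
  have g2 : ∀ x, Good (F2 x) := fun x => stageA_good (g1 x) (b1 x) d zero_le_one le_rfl
  have z2 : ∀ x m, F2 x (0, m) = 0 := by
    intro x m
    by_cases hm : m = d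
    · rw [hm]
      show stageA d 1 (F1 x) (0, d) = 0
      rw [stageA_self]
      exact stageA_one c d hcd.symm
    · exact stageA_one d m hm
  have C2 : Conn F1 F2 := Conn.of_homotopy (fun r x => stageA d r (F1 x))
    (stageA_continuous d continuous_fst (hF1.comp continuous_snd))
    (fun r h0 h1 x => stageA_good (g1 x) (b1 x) d h0 h1)
    (funext fun x => stageA_zero (g1 x) d) rfl
  -- stage B
  let F3 : S → Fin (l + 1) × Fin q → ℝ := fun x => stageB c μ 1 (F2 x)
  have hF3 : Continuous F3 := stageB_continuous c μ continuous_const hF2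
  have g3 : ∀ x, Good (F3 x) := fun x => stageB_good (g2 x) c μ hμ (z2 x) zero_le_one
  have z3 : ∀ x, F3 x (0, c) = 0 := fun x => stageB_apex c μ hμc (z2 x) 1
  have p3 := fun x => stageB_prop (g2 x) c μ
  have C3 : Conn F2 F3 := Conn.of_homotopy (fun r x => stageB c μ r (F2 x))
    (stageB_continuous c μ continuous_fst (hF2.comp continuous_snd))
    (fun r h0 h1 x => stageB_good (g2 x) c μ hμ (z2 x) h0)
    (funext fun x => stageB_zero c μ _) rfl
  -- flow
  let F4 : S → Fin (l + 1) × Fin q → ℝ := fun x => flow c (1 * (1 + ∑ v, F3 x v)) (F3 x)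
  have hs3 : ∀ x, 0 ≤ 1 + ∑ v, F3 x v := fun x =>
    add_nonneg zero_le_one (Finset.sum_nonneg fun v _ => (g3 x).1 v)
  have g4 : ∀ x, Good (F4 x) := fun x =>
    flow_good (g3 x) c (z3 x) (p3 x) (mul_nonneg zero_le_one (hs3 x))
  have C4 : Conn F3 F4 := Conn.of_homotopy (fun r x => flow c (r * (1 + ∑ v, F3 x v)) (F3 x))
    (flow_continuous c (by fun_prop) (hF3.comp continuous_snd))
    (fun r h0 h1 x => flow_good (g3 x) c (z3 x) (p3 x) (mul_nonneg h0 (hs3 x)))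
    (funext fun x => by simp only [zero_mul]; exact flow_zero (g3 x) c) rfl
  have hF4 : Continuous F4 := flow_continuous c (by fun_prop) hF3
  -- cone
  let s1 : Fin (l + 1) := ⟨1, by omega⟩
  have hs1 : s1 ≠ 0 := by
    intro h
    have := congrArg Fin.val h
    simp [s1] at this
  let e : Fin (l + 1) × Fin q → ℝ := Pi.single (s1, c) 1
  have hev : ∀ v, e v ≠ 0 → v = (s1, c) := by
    intro v hv
    by_contra h
    exact hv (Pi.single_eq_of_ne h _)
  have he : Good e := by
    refine ⟨?_, ?_, ?_, ⟨(s1, c), by simp [e]⟩⟩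
    · intro v
      by_cases h : e v = 0
      · rw [h]
      · rw [hev v h]; simp [e]
    · intro s i j hi hj
      have := hev _ hi
      have := hev _ hj
      simp_all
    · intro s m hm hs
      exact absurd (congrArg Prod.fst (hev _ hm)).symm hs1
  have C5 : Conn F4 (fun _ => e) := Conn.of_homotopy
    (fun r x v => (1 - r) * F4 x v + r * e v)
    (by fun_prop)
    (fun r h0 h1 x => linear_good (g4 x) he
      (by
        intro s i j hi hj
        have := hev _ hj
        simp only [Prod.mk.injEq] at this
        rw [this.2]
        by_contra h
        apply hi
        show flow c (1 * (1 + ∑ v, F3 x v)) (F3 x) (s, i) = 0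
        rw [one_mul]
        exact flow_end (g3 x) c (this.1 ▸ hs1) h)
      (by
        intro s m hs hm
        by_contra h
        have := hev _ h
        simp only [Prod.mk.injEq] at this
        apply hm
        rw [this.2]
        show flow c (1 * (1 + ∑ v, F3 x v)) (F3 x) (0, c) = 0
        simpa [flow] using z3 x)
      (by
        intro s m hs hm
        exact absurd (congrArg Prod.fst (hev _ hm)).symm hs1) h0 h1)
    (by funext x v; simp) (by funext x v; simp)
  exact ⟨e, C1.trans (C2.trans (C3.trans (C4.trans C5)))⟩

lemma smooth_approx {t : ℕ} (f : C(sphere (0 : EuclideanSpace ℝ (Fin (t + 1))) 1, ℝ)) {ε : ℝ}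
    (hε : 0 < ε) : ∃ ψ : EuclideanSpace ℝ (Fin (t + 1)) → ℝ, ContDiff ℝ 1 ψ ∧
      ∀ x : sphere (0 : EuclideanSpace ℝ (Fin (t + 1))) 1, |ψ x - f x| < ε := by
  let A : Subalgebra ℝ C(sphere (0 : EuclideanSpace ℝ (Fin (t + 1))) 1, ℝ) :=
    { carrier := {φ | ∃ ψ : EuclideanSpace ℝ (Fin (t + 1)) → ℝ, ContDiff ℝ 1 ψ ∧
        ∀ x : sphere (0 : EuclideanSpace ℝ (Fin (t + 1))) 1, φ x = ψ x}
      mul_mem' := by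
        rintro a b ⟨ψ, h1, h2⟩ ⟨χ, h3, h4⟩
        exact ⟨fun x => ψ x * χ x, h1.mul h3, fun x => by simp [h2, h4]⟩
      add_mem' := by
        rintro a b ⟨ψ, h1, h2⟩ ⟨χ, h3, h4⟩
        exact ⟨fun x => ψ x + χ x, h1.add h3, fun x => by simp [h2, h4]⟩
      algebraMap_mem' := fun r => ⟨fun _ => r, contDiff_const, fun x => by simp⟩ }
  have hA : A.SeparatesPoints := by
    intro x y hxy
    have : ∃ i, x.1 i ≠ y.1 i := by
      by_contra h
      push Not at h
      exact hxy (Subtype.ext (PiLp.ext h))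
    obtain ⟨i, hi⟩ := this
    refine ⟨fun z => z.1 i, ⟨⟨fun z => z.1 i, by fun_prop⟩, ⟨fun z => z i, ?_, fun _ => rfl⟩, rfl⟩,
      hi⟩
    fun_prop
  obtain ⟨⟨g, ψ, h1, h2⟩, hg⟩ :=
    ContinuousMap.exists_mem_subalgebra_near_continuous_of_separatesPoints A hA f f.continuous ε hε
  refine ⟨ψ, h1, fun x => ?_⟩
  rw [← h2, ← Real.norm_eq_abs]
  exact hg x

lemma generic {t : ℕ} (ht : t < l) (h : EuclideanSpace ℝ (Fin (t + 1)) → Fin (l + 1) × Fin q → ℝ)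
    (hh : ContDiff ℝ 1 h) : ∃ b : Fin (l + 1) × Fin q → ℝ, (∀ v, 0 < b v) ∧
      ∀ (σ : Fin (l + 1) → Fin q) (u : EuclideanSpace ℝ (Fin (t + 1))) (ρ : ℝ), ‖u‖ = 1 → 0 < ρ →
        ¬ ∀ s, h u (s, σ s) = ρ * b (s, σ s) := by
  classical
  let Ψ : (σ : Fin (l + 1) → Fin q) →
    (EuclideanSpace ℝ (Fin (t + 1)) × ({v : Fin (l + 1) × Fin q // ¬ v.2 = σ v.1} → ℝ)) →
      Fin (l + 1) × Fin q → ℝ :=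
    fun σ p v => if hv : v.2 = σ v.1 then ‖p.1‖ * h (‖p.1‖⁻¹ • p.1) v else p.2 ⟨v, hv⟩
  let Z := fun (σ : Fin (l + 1) → Fin q) =>
    {p : EuclideanSpace ℝ (Fin (t + 1)) × ({v : Fin (l + 1) × Fin q // ¬ v.2 = σ v.1} → ℝ) |
      p.1 ≠ 0}
  have hdim : ∀ σ, dimH (Ψ σ '' Z σ) ≤ ((t + 1 + ((l + 1) * q - (l + 1)) : ℕ) : ENNReal) := by
    intro σ
    have h1 : dimH (Ψ σ '' Z σ) ≤ dimH (Z σ) := by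
      apply dimH_image_le_of_locally_lipschitzOn
      intro p hp
      have : ContDiffAt ℝ 1 (Ψ σ) p := by
        rw [contDiffAt_pi]
        intro v
        have hp' : p.1 ≠ 0 := hp
        have hn : ContDiffAt ℝ 1 (fun p : EuclideanSpace ℝ (Fin (t + 1)) ×
            ({v : Fin (l + 1) × Fin q // ¬ v.2 = σ v.1} → ℝ) => ‖p.1‖) p :=
          contDiffAt_fst.norm ℝ hp'
        have hhv : ContDiff ℝ 1 (fun u => h u v) := contDiff_pi.1 hh v
        by_cases hv : v.2 = σ v.1
        · simp only [Ψ, hv, dif_pos]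
          refine hn.mul (hhv.contDiffAt.comp p ((hn.inv (norm_ne_zero_iff.2 hp')).smul
            contDiffAt_fst))
        · simp only [Ψ, hv, dif_neg, not_false_eq_true]
          fun_prop
      obtain ⟨K, T, hT, hL⟩ := this.exists_lipschitzOnWith
      exact ⟨K, T, mem_nhdsWithin_of_mem_nhds hT, hL⟩
    refine h1.trans ((dimH_mono (Set.subset_univ _)).trans ?_)
    rw [Real.dimH_univ_eq_finrank]
    apply Nat.cast_le.2
    rw [Module.finrank_prod, finrank_euclideanSpace_fin, Module.finrank_fintype_fun_eq_card,
      Fintype.card_subtype_compl]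
    have e : Fintype.card {v : Fin (l + 1) × Fin q // v.2 = σ v.1} = l + 1 := by
      rw [Fintype.card_congr (β := Fin (l + 1)) ?_, Fintype.card_fin]
      exact ⟨fun v => v.1.1, fun s => ⟨(s, σ s), rfl⟩, fun ⟨⟨s, i⟩, hv⟩ => by
        simp only at hv; subst hv; rfl, fun s => rfl⟩
    rw [e, Fintype.card_prod, Fintype.card_fin, Fintype.card_fin]
  rcases isEmpty_or_nonempty (Fin (l + 1) → Fin q) with hE | hE
  · exact ⟨fun _ => 1, fun _ => one_pos, fun σ => (hE.false σ).elim⟩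
  have hq : 1 ≤ q := (hE.some 0).pos
  have hall : dimH (⋃ σ, Ψ σ '' Z σ) < Module.finrank ℝ (Fin (l + 1) × Fin q → ℝ) := by
    rw [dimH_iUnion]
    refine (iSup_le hdim).trans_lt ?_
    apply Nat.cast_lt.2
    rw [Module.finrank_fintype_fun_eq_card, Fintype.card_prod, Fintype.card_fin, Fintype.card_fin]
    have : (l + 1) ≤ (l + 1) * q := Nat.le_mul_of_pos_right _ hq
    omega
  have hd := dense_compl_of_dimH_lt_finrank hall
  have ho : IsOpen (Set.univ.pi fun _ : Fin (l + 1) × Fin q => Set.Ioi (0 : ℝ)) :=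
    isOpen_set_pi Set.finite_univ fun _ _ => isOpen_Ioi
  obtain ⟨b, hb1, hb2⟩ := hd.inter_open_nonempty _ ho ⟨fun _ => 1, fun _ _ => Set.mem_Ioi.2 one_pos⟩
  refine ⟨b, fun v => hb1 v trivial, ?_⟩
  intro σ u ρ hu hρ hcon
  apply hb2
  have hu0 : u ≠ 0 := by
    rintro rfl
    simp at hu
  refine Set.mem_iUnion.2 ⟨σ, (ρ⁻¹ • u, fun v => b v.1), ?_, ?_⟩
  · exact smul_ne_zero (inv_ne_zero hρ.ne') hu0
  · ext ⟨s, i⟩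
    by_cases hv : i = σ s
    · subst hv
      have hnorm : ‖ρ⁻¹ • u‖ = ρ⁻¹ := by
        rw [norm_smul, hu, mul_one, Real.norm_of_nonneg (inv_pos.2 hρ).le]
      simp only [Ψ, dif_pos, hnorm, inv_inv, smul_smul, mul_inv_cancel₀ hρ.ne', one_smul]
      rw [hcon s, inv_mul_cancel_left₀ hρ.ne']
    · simp only [Ψ, hv, dif_neg, not_false_eq_true]

lemma good_of_mem {w : Fin (l + 1) × Fin q → ℝ} (hw : w ∈ CRealization l q) : Good w := by
  obtain ⟨h1, h2, h3, h4⟩ := hw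
  refine ⟨h1, fun s i j hi hj => congrArg Prod.snd (h3 (s, i) (s, j) hi hj rfl), h4, ?_⟩
  by_contra h
  push Not at h
  simp [h] at h2

lemma sum_pos_of_good {w : Fin (l + 1) × Fin q → ℝ} (hw : Good w) : 0 < ∑ v, w v := by
  obtain ⟨v, hv⟩ := hw.2.2.2
  exact Finset.sum_pos' (fun v _ => hw.1 v)
    ⟨v, Finset.mem_univ _, lt_of_le_of_ne (hw.1 v) (Ne.symm hv)⟩

lemma normalize_mem {w : Fin (l + 1) × Fin q → ℝ} (hw : Good w) :
    (fun v => w v / ∑ v, w v) ∈ CRealization l q := by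
  have hp := sum_pos_of_good hw
  refine ⟨fun v => div_nonneg (hw.1 v) hp.le, ?_, ?_, ?_⟩
  · rw [← Finset.sum_div, div_self hp.ne']
  · rintro ⟨s, i⟩ ⟨s', j⟩ h1 h2 h
    simp only at h
    subst h
    rw [hw.2.1 s i j (fun h => h1 (by simp [h])) (fun h => h2 (by simp [h]))]
  · intro s m h hs
    show w (s, m) / _ = 0
    rw [hw.2.2.1 s m (fun h' => h (by simp [h'])) hs, zero_div]

noncomputable def normalize :
    C({w : Fin (l + 1) × Fin q → ℝ // Good w}, CRealization l q) :=
  ⟨fun w => ⟨_, normalize_mem w.2⟩, by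
    refine Continuous.subtype_mk (continuous_pi fun v => ?_) _
    have hv : ∀ v, Continuous fun w : {w : Fin (l + 1) × Fin q → ℝ // Good w} => w.1 v :=
      fun v => (continuous_apply v).comp continuous_subtype_val
    exact Continuous.div (hv v) (continuous_finsetSum _ fun v _ => hv v) fun w => ne_of_gt (sum_pos_of_good w.2)⟩

/-- Every map from a low dimensional sphere is null-homotopic. -/
lemma nullhomotopic {t : ℕ} (ht : t < l) (hl : 1 ≤ l) (hlq : l < q - 1)
    (f : C(sphere (0 : EuclideanSpace ℝ (Fin (t + 1))) 1, CRealization l q)) :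
    ∃ e, f.Homotopic (ContinuousMap.const _ e) := by
  have hN : (0 : ℝ) < Fintype.card (Fin (l + 1) × Fin q) := by
    have : 0 < Fintype.card (Fin (l + 1) × Fin q) := by
      rw [Fintype.card_prod, Fintype.card_fin, Fintype.card_fin]
      exact Nat.mul_pos (by omega) (by omega)
    exact_mod_cast this
  set N : ℝ := ((Fintype.card (Fin (l + 1) × Fin q) : ℕ) : ℝ) with hNdef
  let ε : ℝ := 1 / (2 * N)
  have hε : 0 < ε := by positivity
  have hfc : ∀ v, Continuous fun x => (f x).1 v := fun v =>
    (continuous_apply v).comp (continuous_subtype_val.comp f.continuous)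
  have hgf : ∀ x, Good (f x).1 := fun x => good_of_mem (f x).2
  choose ψ hψ1 hψ2 using fun v => smooth_approx ⟨_, hfc v⟩ hε
  simp only [ContinuousMap.coe_mk] at hψ2
  let h : EuclideanSpace ℝ (Fin (t + 1)) → Fin (l + 1) × Fin q → ℝ :=
    fun u v => expNegInvGlue (ψ v u - ε)
  have hh : ContDiff ℝ 1 h := by
    rw [contDiff_pi]
    intro v
    exact (expNegInvGlue.contDiff (n := 1)).comp ((hψ1 v).sub contDiff_const)
  obtain ⟨b, hb, hgen⟩ := generic ht h hh
  let G : sphere (0 : EuclideanSpace ℝ (Fin (t + 1))) 1 → Fin (l + 1) × Fin q → ℝ :=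
    fun x v => h x.1 v / b v
  have hG : Continuous G := by
    refine continuous_pi fun v => ?_
    have : Continuous fun u => h u v := (continuous_apply v).comp hh.continuous
    exact (this.comp continuous_subtype_val).div_const _
  have hsupp : ∀ x v, G x v ≠ 0 → (f x).1 v ≠ 0 := by
    intro x v hv h0
    have h1 : h x.1 v ≠ 0 := by
      intro h'
      exact hv (by simp [G, h'])
    have h2 : ¬ ψ v x.1 - ε ≤ 0 := fun h' => h1 (expNegInvGlue.zero_of_nonpos h')
    have h3 := (abs_lt.1 (hψ2 v x)).2
    rw [h0] at h3
    exact h2 (by linarith)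
  have hGg : ∀ x, Good (G x) := by
    intro x
    refine ⟨fun v => div_nonneg (expNegInvGlue.nonneg _) (hb v).le, ?_, ?_, ?_⟩
    · intro s i j hi hj
      exact (hgf x).2.1 s i j (hsupp x _ hi) (hsupp x _ hj)
    · intro s m hm hs
      by_contra h'
      exact hsupp x _ h' ((hgf x).2.2.1 s m (hsupp x _ hm) hs)
    · have : ∃ v ∈ Finset.univ, 1 / N ≤ (f x).1 v := by
        apply Finset.exists_le_of_sum_le
        · rw [← Finset.card_pos, Finset.card_univ]
          exact Nat.cast_pos.1 (hNdef ▸ hN)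
        · rw [(f x).2.2.1, Finset.sum_const, Finset.card_univ, nsmul_eq_mul, ← hNdef,
            mul_one_div_cancel hN.ne']
      obtain ⟨v, -, hv⟩ := this
      refine ⟨v, (div_pos (expNegInvGlue.pos_of_pos ?_) (hb v)).ne'⟩
      have h3 := (abs_lt.1 (hψ2 v x)).1
      have h4 : 1 / N = 2 * ε := by
        simp only [ε]
        field_simp
      linarith
  have hGb : ∀ x, NotBary (G x) := by
    intro x σ ρ hρ hcon
    refine hgen σ x.1 ρ (by simp) hρ fun s => ?_
    rw [← hcon s]
    exact (div_mul_cancel₀ _ (hb _).ne').symm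
  have C0 : Conn (fun x => (f x).1) G := Conn.of_homotopy
    (fun r x v => (1 - r) * (f x).1 v + r * G x v)
    (by fun_prop)
    (fun r h0 h1 x => linear_good (hgf x) (hGg x)
      (fun s i j hi hj => (hgf x).2.1 s i j hi (hsupp x _ hj))
      (fun s m hs hm => by
        by_contra h'
        exact hsupp x _ h' ((hgf x).2.2.1 s m hm hs))
      (fun s m hs hm => (hgf x).2.2.1 s m (hsupp x _ hm) hs) h0 h1)
    (by funext x v; simp) (by funext x v; simp)
  obtain ⟨e, C1⟩ := conn_of_notBary hl hlq G hG hGg hGb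
  obtain ⟨F', G', h1, h2, h3⟩ := C0.trans C1
  have hS : Nonempty (sphere (0 : EuclideanSpace ℝ (Fin (t + 1))) 1) :=
    (NormedSpace.sphere_nonempty.2 zero_le_one).to_subtype
  obtain ⟨x₀⟩ := hS
  refine ⟨normalize (G' x₀), ?_⟩
  have e1 : normalize.comp F' = f := by
    ext x v
    show (F' x).1 v / ∑ v, (F' x).1 v = (f x).1 v
    rw [h1 x, (f x).2.2.1, div_one]
  have e2 : normalize.comp G' = ContinuousMap.const _ (normalize (G' x₀)) := by
    ext1 x
    show normalize (G' x) = normalize (G' x₀)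
    congr 1
    exact Subtype.ext ((h2 x).trans (h2 x₀).symm)
  rw [← e1, ← e2]
  exact (ContinuousMap.Homotopic.refl normalize).comp h3

lemma extend_of_nullhomotopic {t : ℕ} {X : Type*} [TopologicalSpace X]
    (f : C(sphere (0 : EuclideanSpace ℝ (Fin (t + 1))) 1, X)) {e : X}
    (hf : f.Homotopic (ContinuousMap.const _ e)) :
    ∃ g : C(closedBall (0 : EuclideanSpace ℝ (Fin (t + 1))) 1, X),
      ∀ x : sphere (0 : EuclideanSpace ℝ (Fin (t + 1))) 1,
        g ⟨x.1, sphere_subset_closedBall x.2⟩ = f x := by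
  obtain ⟨H⟩ := hf.symm
  let π : C(unitInterval × sphere (0 : EuclideanSpace ℝ (Fin (t + 1))) 1,
      closedBall (0 : EuclideanSpace ℝ (Fin (t + 1))) 1) :=
    ⟨fun p => ⟨(p.1 : ℝ) • p.2.1, by
      have h2 : ‖p.2.1‖ = 1 := by simp
      rw [mem_closedBall_zero_iff, norm_smul, h2, mul_one, Real.norm_of_nonneg p.1.2.1]
      exact p.1.2.2⟩, by fun_prop⟩
  have hnorm : ∀ p, ‖(π p).1‖ = p.1 := by
    intro p
    have h2 : ‖p.2.1‖ = 1 := by simp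
    show ‖(p.1 : ℝ) • p.2.1‖ = _
    rw [norm_smul, h2, mul_one, Real.norm_of_nonneg p.1.2.1]
  have hsurj : Function.Surjective π := by
    rintro ⟨y, hy⟩
    rw [mem_closedBall_zero_iff] at hy
    by_cases h0 : y = 0
    · obtain ⟨x₀, hx₀⟩ := NormedSpace.sphere_nonempty (x := (0 : EuclideanSpace ℝ (Fin (t + 1))))
        |>.2 zero_le_one
      exact ⟨(0, ⟨x₀, hx₀⟩), Subtype.ext (by simp [π, h0])⟩
    · refine ⟨(⟨‖y‖, norm_nonneg _, hy⟩, ⟨‖y‖⁻¹ • y, ?_⟩), Subtype.ext ?_⟩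
      · rw [mem_sphere_zero_iff_norm, norm_smul, norm_inv, norm_norm,
          inv_mul_cancel₀ (norm_ne_zero_iff.2 h0)]
      · simp [π, smul_smul, mul_inv_cancel₀ (norm_ne_zero_iff.2 h0)]
  have hq : Topology.IsQuotientMap π := π.continuous.isClosedMap.isQuotientMap π.continuous hsurj
  have hfac : Function.FactorsThrough H.toContinuousMap π := by
    intro p p' hpp
    have h1 : p.1 = p'.1 := Subtype.ext (by rw [← hnorm p, ← hnorm p', hpp])
    obtain ⟨r, x⟩ := p
    obtain ⟨r', x'⟩ := p'
    simp only at h1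
    subst h1
    by_cases hr : r = 0
    · subst hr
      show H (0, x) = H (0, x')
      rw [H.apply_zero, H.apply_zero]
      rfl
    · have h2 := congrArg Subtype.val hpp
      have h3 : (r : ℝ) • x.1 = (r : ℝ) • x'.1 := h2
      have hr' : (r : ℝ) ≠ 0 := fun h => hr (Subtype.ext h)
      have : x = x' := Subtype.ext (smul_right_injective _ hr' h3)
      rw [this]
  refine ⟨hq.lift H.toContinuousMap hfac, fun x => ?_⟩
  have h1 : π (1, x) = ⟨x.1, sphere_subset_closedBall x.2⟩ := Subtype.ext (by simp [π])
  have h2 : hq.lift H.toContinuousMap hfac (π (1, x)) = H (1, x) :=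
    congrArg (fun F => F (1, x)) (hq.lift_comp H.toContinuousMap hfac)
  rw [← h1, h2, H.apply_one]

end CLQ

/-- For q > 2 and 1 ≤ l < q − 1, the complex C_{l,q} is (l − 1)-connected. -/
theorem C_lq_connectivity (l q : ℕ) (hq : 2 < q) (hl : 1 ≤ l) (hlq : l < q - 1) :
    IsKConnected (CRealization l q) ((l : ℤ) - 1) := by

  refine ⟨fun _ => ?_, fun t ht f => ?_⟩
  · let c : Fin q := ⟨0, by omega⟩
    have hev : ∀ v, (Pi.single (0, c) 1 : Fin (l + 1) × Fin q → ℝ) v ≠ 0 → v = (0, c) := by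
      intro v hv
      by_contra h
      exact hv (Pi.single_eq_of_ne h _)
    refine ⟨⟨Pi.single (0, c) 1, ?_, ?_, ?_, ?_⟩⟩
    · intro v
      exact (Pi.single_nonneg.2 zero_le_one : (0 : Fin (l + 1) × Fin q → ℝ) ≤ _) v
    · simp
    · intro p r hp hr _
      rw [hev p hp, hev r hr]
    · intro s m hm hs
      by_contra h
      exact hs (congrArg Prod.fst (hev _ h))
  · obtain ⟨e, he⟩ := CLQ.nullhomotopic (by omega) hl hlq f
    exact CLQ.extend_of_nullhomotopic f he
end

section
/- For q = 3 and d = 2: every set X of 7 points in general position in ℝ² that has only Type II Tverberg partitions (no Tverberg point equal to one of the points of X) has at least 4 Tverberg partitions into 3 parts. -/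
/-- A Tverberg partition of a finite point set `X ⊆ ℝ^d` into `q` parts:
a partition of `X` into `q` subsets whose convex hulls have a common point. -/
def IsTverbergPartition (d q : ℕ) (X : Finset (EuclideanSpace ℝ (Fin d)))
    (P : Finset (Finset (EuclideanSpace ℝ (Fin d)))) : Prop :=
  P.card = q ∧ (∀ S ∈ P, S ⊆ X) ∧ (∀ x ∈ X, ∃! S, S ∈ P ∧ x ∈ S) ∧
  (⋂ S ∈ P, convexHull ℝ (S : Set (EuclideanSpace ℝ (Fin d)))).Nonempty

namespace Tv

abbrev E2 := EuclideanSpace ℝ (Fin 2)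

/-- Orientation determinant. -/
noncomputable def D (a b c : E2) : ℝ :=
  (b 0 - a 0) * (c 1 - a 1) - (b 1 - a 1) * (c 0 - a 0)

/-- The linear functional vanishing in direction `b - a`. -/
noncomputable def L (a b : E2) : E2 →ₗ[ℝ] ℝ :=
  IsLinearMap.mk' (fun x => (b 0 - a 0) * x 1 - (b 1 - a 1) * x 0)
    ⟨by intro x y; simp; ring, by intro r x; simp; ring⟩

lemma L_apply (a b x : E2) : L a b x = (b 0 - a 0) * x 1 - (b 1 - a 1) * x 0 := rfl

lemma D_eq (a b x : E2) : D a b x = L a b x - L a b a := by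
  simp only [D, L_apply]; ring

structure GP (X : Finset E2) : Prop where
  card : X.card = 7
  coll : ∀ a ∈ X, ∀ b ∈ X, ∀ c ∈ X, a ≠ b → a ≠ c → b ≠ c → D a b c ≠ 0
  conc : ∀ a ∈ X, ∀ b ∈ X, ∀ c ∈ X, ∀ d ∈ X, ∀ e ∈ X, ∀ f ∈ X,
    [a, b, c, d, e, f].Nodup → ∀ p, D a b p = 0 → D c d p = 0 → D e f p = 0 → False

lemma algInd_aux {ι : Type} {x : ι → ℝ} (h : AlgebraicIndependent ℚ x) (P : MvPolynomial ι ℚ)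
    (hP : MvPolynomial.aeval x P = 0) (y : ι → ℚ) : MvPolynomial.eval y P = 0 := by
  rw [h.eq_zero_of_aeval_eq_zero P hP]; simp

lemma GP.of_gen (X : Finset E2) (hcard : X.card = 7)
    (hgen : AlgebraicIndependent ℚ (fun p : {x // x ∈ X} × Fin 2 => (p.1 : E2) p.2)) :
    GP X := by
  refine ⟨hcard, ?_, ?_⟩
  · intro a ha b hb c hc hab hac hbc h0
    let g : Fin 3 → {x // x ∈ X} := ![⟨a, ha⟩, ⟨b, hb⟩, ⟨c, hc⟩]
    have hg : Function.Injective g := by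
      intro i j hij
      fin_cases i <;> fin_cases j <;> simp_all [g]
    have h := hgen.comp (fun q : Fin 3 × Fin 2 => (g q.1, q.2))
      (by rintro ⟨i, k⟩ ⟨j, l⟩ hij; simp only [Prod.mk.injEq] at hij ⊢; exact ⟨hg hij.1, hij.2⟩)
    let V : Fin 3 → Fin 2 → MvPolynomial (Fin 3 × Fin 2) ℚ := fun i k => MvPolynomial.X (i, k)
    have := algInd_aux h ((V 1 0 - V 0 0) * (V 2 1 - V 0 1) - (V 1 1 - V 0 1) * (V 2 0 - V 0 0))
      (by simpa [V, g, D] using h0) (fun q => ![![0, 0], ![1, 0], ![0, 1]] q.1 q.2)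
    simp [V] at this
  · intro a ha b hb c hc d hd e he f hf hn p h1 h2 h3
    let g : Fin 6 → {x // x ∈ X} := ![⟨a, ha⟩, ⟨b, hb⟩, ⟨c, hc⟩, ⟨d, hd⟩, ⟨e, he⟩, ⟨f, hf⟩]
    have hg : Function.Injective g := by
      have h6 : Function.Injective ([a, b, c, d, e, f].get) := List.nodup_iff_injective_get.1 hn
      have : ∀ i : Fin 6, (g i : E2) = [a, b, c, d, e, f].get i := by
        intro i; fin_cases i <;> rfl
      intro i j hij
      apply h6
      rw [← this, ← this, hij]
    have h := hgen.comp (fun q : Fin 6 × Fin 2 => (g q.1, q.2))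
      (by rintro ⟨i, k⟩ ⟨j, l⟩ hij; simp only [Prod.mk.injEq] at hij ⊢; exact ⟨hg hij.1, hij.2⟩)
    let V : Fin 6 → Fin 2 → MvPolynomial (Fin 6 × Fin 2) ℚ := fun i k => MvPolynomial.X (i, k)
    let A : Fin 6 → Fin 6 → MvPolynomial (Fin 6 × Fin 2) ℚ := fun i j => V i 1 - V j 1
    let B : Fin 6 → Fin 6 → MvPolynomial (Fin 6 × Fin 2) ℚ := fun i j => V j 0 - V i 0
    let C : Fin 6 → Fin 6 → MvPolynomial (Fin 6 × Fin 2) ℚ := fun i j =>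
      V i 0 * V j 1 - V i 1 * V j 0
    have := algInd_aux h (A 0 1 * (B 2 3 * C 4 5 - C 2 3 * B 4 5)
        - B 0 1 * (A 2 3 * C 4 5 - C 2 3 * A 4 5) + C 0 1 * (A 2 3 * B 4 5 - B 2 3 * A 4 5))
      (by
        simp only [D] at h1 h2 h3
        simp [V, g, A, B, C]
        linear_combination ((c 1 - d 1) * (f 0 - e 0) - (d 0 - c 0) * (e 1 - f 1)) * h1
          - ((a 1 - b 1) * (f 0 - e 0) - (b 0 - a 0) * (e 1 - f 1)) * h2
          + ((a 1 - b 1) * (d 0 - c 0) - (b 0 - a 0) * (c 1 - d 1)) * h3)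
      (fun q => ![![0, 0], ![1, 0], ![0, 0], ![0, 1], ![1, 0], ![0, 1]] q.1 q.2)
    simp [V, A, B, C] at this

/-- Face lemma. -/
lemma face {S : Finset E2} {p : E2} (f : E2 →ₗ[ℝ] ℝ) (hp : p ∈ convexHull ℝ (S : Set E2))
    (h : ∀ x ∈ S, f x ≤ f p) :
    p ∈ convexHull ℝ ((S.filter (fun x => f x = f p) : Finset E2) : Set E2) := by
  rw [Finset.mem_convexHull'] at hp ⊢
  obtain ⟨w, hw0, hw1, hwp⟩ := hp
  have key : ∑ y ∈ S, w y * (f p - f y) = 0 := by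
    have : f p = ∑ y ∈ S, w y * f y := by
      conv_lhs => rw [← hwp]
      simp [map_sum]
    simp only [mul_sub, Finset.sum_sub_distrib, ← Finset.sum_mul, hw1, ← this]; ring
  rw [Finset.sum_eq_zero_iff_of_nonneg
    (fun y hy => mul_nonneg (hw0 y hy) (sub_nonneg.2 (h y hy)))] at key
  have hz : ∀ y ∈ S, f y ≠ f p → w y = 0 := by
    intro y hy hne
    rcases mul_eq_zero.1 (key y hy) with h' | h'
    · exact h'
    · exact absurd (by linarith) hne
  refine ⟨w, fun y hy => hw0 y (Finset.mem_filter.1 hy).1, ?_, ?_⟩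
  · rw [Finset.sum_filter_of_ne, hw1]
    intro x hx hne; by_contra hc; exact hne (hz x hx hc)
  · rw [Finset.sum_filter_of_ne, hwp]
    intro x hx hne; by_contra hc; exact hne (by rw [hz x hx hc, zero_smul])

/-- halfplane lemma -/
lemma conv_le {S : Finset E2} {p : E2} (f : E2 →ₗ[ℝ] ℝ) (r : ℝ)
    (hp : p ∈ convexHull ℝ (S : Set E2)) (h : ∀ x ∈ S, f x ≤ r) : f p ≤ r := by
  have : convexHull ℝ (S : Set E2) ⊆ {x | f x ≤ r} :=
    convexHull_min (fun x hx => h x hx) (convex_halfSpace_le f.isLinear r)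
  exact this hp

/-- The center region. -/
def C (X : Finset E2) : Set E2 :=
  {p | ∀ S ⊆ X, S.card = 5 → p ∈ convexHull ℝ (S : Set E2)}

lemma C_eq (X : Finset E2) : C X = ⋂ S ∈ X.powersetCard 5, convexHull ℝ (S : Set E2) := by
  ext p; simp [C, Finset.mem_powersetCard]

lemma C_convex (X : Finset E2) : Convex ℝ (C X) := by
  rw [C_eq]; exact convex_iInter₂ fun S _ => convex_convexHull ℝ _

lemma C_compact {X : Finset E2} (hX : GP X) : IsCompact (C X) := by
  obtain ⟨S, hS, hc⟩ := Finset.exists_subset_card_eq (show 5 ≤ X.card by rw [hX.card]; norm_num)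
  have hcl : IsClosed (C X) := by
    rw [C_eq]
    exact isClosed_biInter fun S _ => S.finite_toSet.isClosed_convexHull ℝ
  exact (S.finite_toSet.isCompact_convexHull ℝ).of_isClosed_subset hcl fun p hp => hp S hS hc

lemma C_nonempty {X : Finset E2} (hX : GP X) : (C X).Nonempty := by
  classical
  rw [C_eq]
  apply Convex.helly_theorem' (𝕜 := ℝ)
  · intro S _; exact convex_convexHull ℝ _
  · intro I hI hcard
    have hfr : Module.finrank ℝ E2 = 2 := by simp
    rw [hfr] at hcard
    have hU : (I.biUnion (fun S => X \ S)).card ≤ 6 := by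
      calc _ ≤ I.card * 2 := Finset.card_biUnion_le_card_mul _ _ _ (by
            intro S hS
            obtain ⟨h1, h2⟩ := Finset.mem_powersetCard.1 (hI hS)
            rw [Finset.card_sdiff_of_subset h1, hX.card, h2])
        _ ≤ 6 := by omega
    obtain ⟨x, hx, hxn⟩ := Finset.exists_mem_notMem_of_card_lt_card
      (lt_of_le_of_lt hU (by rw [hX.card]; norm_num : 6 < X.card))
    refine ⟨x, ?_⟩
    simp only [Set.mem_iInter]
    intro S hS
    apply subset_convexHull
    by_contra hc
    exact hxn (Finset.mem_biUnion.2 ⟨S, hS, Finset.mem_sdiff.2 ⟨hx, hc⟩⟩)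

end Tv

namespace Tv

open Classical in
lemma mk_partition {X S₁ S₂ S₃ : Finset E2} {y : E2} (hX : X = S₁ ∪ S₂ ∪ S₃)
    (h12 : Disjoint S₁ S₂) (h13 : Disjoint S₁ S₃) (h23 : Disjoint S₂ S₃)
    (h1 : y ∈ convexHull ℝ (S₁ : Set E2)) (h2 : y ∈ convexHull ℝ (S₂ : Set E2))
    (h3 : y ∈ convexHull ℝ (S₃ : Set E2)) :
    IsTverbergPartition 2 3 X {S₁, S₂, S₃} ∧
      y ∈ ⋂ S ∈ ({S₁, S₂, S₃} : Finset (Finset E2)), convexHull ℝ (S : Set E2) := by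
  have ne : ∀ S : Finset E2, y ∈ convexHull ℝ (S : Set E2) → S ≠ ∅ := by
    rintro S hS rfl; simp at hS
  have n12 : S₁ ≠ S₂ := by rintro rfl; exact ne _ h1 (by simpa using h12)
  have n13 : S₁ ≠ S₃ := by rintro rfl; exact ne _ h1 (by simpa using h13)
  have n23 : S₂ ≠ S₃ := by rintro rfl; exact ne _ h2 (by simpa using h23)
  have hy : y ∈ ⋂ S ∈ ({S₁, S₂, S₃} : Finset (Finset E2)), convexHull ℝ (S : Set E2) := by
    simp [h1, h2, h3]
  refine ⟨⟨?_, ?_, ?_, ⟨y, hy⟩⟩, hy⟩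
  · exact Finset.card_eq_three.2 ⟨_, _, _, n12, n13, n23, rfl⟩
  · intro S hS x hx
    simp only [Finset.mem_insert, Finset.mem_singleton] at hS
    rw [hX]
    rcases hS with rfl | rfl | rfl <;> simp [hx]
  · intro x hx
    rw [Finset.disjoint_left] at h12 h13 h23
    rw [hX] at hx
    simp only [Finset.mem_union] at hx
    rcases hx with (hx | hx) | hx
    · refine ⟨S₁, by simp [hx], ?_⟩
      rintro T ⟨hT, hxT⟩
      simp only [Finset.mem_insert, Finset.mem_singleton] at hT
      rcases hT with rfl | rfl | rfl
      · rfl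
      · exact absurd hxT (h12 hx)
      · exact absurd hxT (h13 hx)
    · refine ⟨S₂, by simp [hx], ?_⟩
      rintro T ⟨hT, hxT⟩
      simp only [Finset.mem_insert, Finset.mem_singleton] at hT
      rcases hT with rfl | rfl | rfl
      · exact absurd hx (h12 hxT)
      · rfl
      · exact absurd hxT (h23 hx)
    · refine ⟨S₃, by simp [hx], ?_⟩
      rintro T ⟨hT, hxT⟩
      simp only [Finset.mem_insert, Finset.mem_singleton] at hT
      rcases hT with rfl | rfl | rfl
      · exact absurd hx (h13 hxT)
      · exact absurd hx (h23 hxT)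
      · rfl

lemma conv3 {K : Set E2} (hK : Convex ℝ K) {u v w : E2} (hu : u ∈ K) (hv : v ∈ K) (hw : w ∈ K)
    {α β γ : ℝ} (ha : 0 ≤ α) (hb : 0 ≤ β) (hc : 0 ≤ γ) (h : α + β + γ = 1) :
    α • u + β • v + γ • w ∈ K := by
  have := hK.sum_mem (t := Finset.univ) (w := ![α, β, γ]) (z := ![u, v, w])
    (by intro i _; fin_cases i <;> simpa) (by simp [Fin.sum_univ_three, h])
    (by intro i _; fin_cases i <;> simpa)
  simpa [Fin.sum_univ_three] using this

lemma mem_tri {K : Set E2} (hK : Convex ℝ K) {z u v w : E2} (hu : u ∈ K) (hv : v ∈ K) (hw : w ∈ K)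
    (h1 : 0 ≤ D z u v) (h2 : 0 ≤ D z v w) (h3 : 0 ≤ D z w u) (hs : 0 < D u v w) : z ∈ K := by
  have hsum : D z v w + D z w u + D z u v = D u v w := by simp only [D]; ring
  have := conv3 hK hu hv hw (α := D z v w / D u v w) (β := D z w u / D u v w)
    (γ := D z u v / D u v w) (by positivity) (by positivity) (by positivity)
    (by rw [← add_div, ← add_div, hsum]; field_simp)
  convert this using 1
  ext i
  have hne := hs.ne'
  fin_cases i
  · simp
    field_simp
    simp only [D]; ring
  · simp
    field_simp
    simp only [D]; ring

section Tournament
variable {α : Type*} [DecidableEq α] (Y : Finset α) (R : α → α → Prop)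

structure Tour : Prop where
  tot : ∀ x ∈ Y, ∀ y ∈ Y, x ≠ y → R x y ∨ R y x
  asym : ∀ x y, R x y → ¬ R y x
  hout : ∀ u ∈ Y, ∀ T ⊆ Y, T.card = 4 → (∀ x ∈ T, R u x) → False
  hin : ∀ u ∈ Y, ∀ T ⊆ Y, T.card = 4 → (∀ x ∈ T, R x u) → False
  tout : ∀ r a b c, R r a → R r b → R r c → R a b → R b c → R c a → False
  tin : ∀ r a b c, R a r → R b r → R c r → R a b → R b c → R c a → False

variable {Y R}

lemma Tour.flip (h : Tour Y R) : Tour Y (fun x y => R y x) where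
  tot x hx y hy hxy := (h.tot x hx y hy hxy).symm
  asym x y := h.asym y x
  hout := h.hin
  hin := h.hout
  tout r a b c h1 h2 h3 h4 h5 h6 := h.tin r a c b h1 h3 h2 h6 h5 h4
  tin r a b c h1 h2 h3 h4 h5 h6 := h.tout r a c b h1 h3 h2 h6 h5 h4

lemma card4 {a b c d : α} (h : [a, b, c, d].Nodup) : ({a, b, c, d} : Finset α).card = 4 := by
  have := List.toFinset_card_of_nodup h
  simpa using this

lemma Tour.core (h : Tour Y R) {u x y r s t : α} (hn : [u, x, y, r, s, t].Nodup)
    (hu : u ∈ Y) (hx : x ∈ Y) (hy : y ∈ Y) (hr : r ∈ Y) (hs : s ∈ Y) (ht : t ∈ Y)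
    (ux : R u x) (uy : R u y) (ru : R r u) (su : R s u) (tu : R t u) (xy : R x y)
    (rs : R r s) (st : R s t) (rt : R r t) : R y s ∧ R x r ∧ R t x := by
  have hn' := hn
  simp only [List.nodup_cons, List.mem_cons, not_or, List.not_mem_nil, not_false_eq_true,
    and_true] at hn'
  obtain ⟨⟨n1, n2, n3, n4, n5⟩, ⟨n6, n7, n8, n9⟩, ⟨n10, n11, n12⟩, ⟨n13, n14⟩, n15, -⟩ := hn'
  have out4 : ∀ v ∈ Y, ∀ a ∈ Y, ∀ b ∈ Y, ∀ c ∈ Y, ∀ d ∈ Y, [a, b, c, d].Nodup →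
      R v a → R v b → R v c → R v d → False := by
    intro v hv a ha b hb c hc d hd hnn h1 h2 h3 h4
    refine h.hout v hv {a, b, c, d} ?_ (card4 hnn) ?_
    · intro w hw; simp at hw; rcases hw with rfl | rfl | rfl | rfl <;> assumption
    · intro w hw; simp at hw; rcases hw with rfl | rfl | rfl | rfl <;> assumption
  have in4 : ∀ v ∈ Y, ∀ a ∈ Y, ∀ b ∈ Y, ∀ c ∈ Y, ∀ d ∈ Y, [a, b, c, d].Nodup →
      R a v → R b v → R c v → R d v → False := by
    intro v hv a ha b hb c hc d hd hnn h1 h2 h3 h4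
    refine h.hin v hv {a, b, c, d} ?_ (card4 hnn) ?_
    · intro w hw; simp at hw; rcases hw with rfl | rfl | rfl | rfl <;> assumption
    · intro w hw; simp at hw; rcases hw with rfl | rfl | rfl | rfl <;> assumption
  have tx : R t x := by
    rcases h.tot t ht x hx (Ne.symm n9) with h1 | h1
    · exact h1
    · exfalso
      rcases h.tot t ht y hy (Ne.symm n12) with h2 | h2
      · exact h.tin y u x t uy xy h2 ux h1 tu
      · exact in4 t ht r hr s hs x hx y hy (by simp; grind) rt st h1 h2
  have yr : R y r := by
    rcases h.tot y hy r hr n10 with h1 | h1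
    · exact h1
    · exact (out4 r hr s hs t ht u hu y hy (by simp; grind) rs rt ru h1).elim
  have xr : R x r := by
    rcases h.tot x hx r hr n7 with h1 | h1
    · exact h1
    · exact (out4 r hr s hs t ht u hu x hx (by simp; grind) rs rt ru h1).elim
  refine ⟨?_, xr, tx⟩
  rcases h.tot y hy s hs n11 with h1 | h1
  · exact h1
  · exfalso
    rcases h.tot y hy t ht n12 with h2 | h2
    · exact h.tout s u y t su h1 st uy h2 tu
    · exact in4 y hy u hu x hx s hs t ht (by simp; grind) uy xy h1 h2

lemma Tour.aux (h : Tour Y R) {u : α} (hu : u ∈ Y) {A B : Finset α} (hA : A.card = 2)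
    (hB : B.card = 3) (hY : Y = insert u (A ∪ B)) (huA : u ∉ A) (huB : u ∉ B)
    (hAB : Disjoint A B) (hRA : ∀ x ∈ A, R u x) (hRB : ∀ x ∈ B, R x u) :
    ∃ a b c d e f, Y = {a, b, c, d, e, f} ∧ [a, b, c, d, e, f].Nodup ∧
      R a b ∧ R b c ∧ R c a ∧ R d e ∧ R e f ∧ R f d := by
  have fin : ∀ x y r s t, A = {x, y} → B = {r, s, t} → x ≠ y → r ≠ s → r ≠ t → s ≠ t →
      R x y → R r s → R s t → R r t → 
      ∃ a b c d e f, Y = {a, b, c, d, e, f} ∧ [a, b, c, d, e, f].Nodup ∧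
      R a b ∧ R b c ∧ R c a ∧ R d e ∧ R e f ∧ R f d := by
    rintro x y r s t rfl rfl nxy nrs nrt nst xy rs st rt
    have hd : [u, x, y, r, s, t].Nodup := by
      simp at huA huB hAB ⊢; grind
    have := h.core hd hu (by simp [hY]) (by simp [hY]) (by simp [hY]) (by simp [hY])
      (by simp [hY]) (hRA x (by simp)) (hRA y (by simp)) (hRB r (by simp)) (hRB s (by simp))
      (hRB t (by simp)) xy rs st rt
    refine ⟨u, y, s, x, r, t, ?_, ?_, hRA y (by simp), this.1, hRB s (by simp), this.2.1, rt,
      this.2.2⟩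
    · rw [hY]; ext w; simp; grind
    · simp at hd ⊢; grind
  obtain ⟨x, y, nxy, rfl⟩ := Finset.card_eq_two.1 hA
  obtain ⟨r, s, t, nrs, nrt, nst, rfl⟩ := Finset.card_eq_three.1 hB
  have fin2 : ∀ r' s' t', ({r, s, t} : Finset α) = {r', s', t'} → r' ≠ s' → r' ≠ t' → s' ≠ t' →
      R r' s' → R s' t' → R r' t' → 
      ∃ a b c d e f, Y = {a, b, c, d, e, f} ∧ [a, b, c, d, e, f].Nodup ∧
      R a b ∧ R b c ∧ R c a ∧ R d e ∧ R e f ∧ R f d := by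
    intro r' s' t' hB' n1 n2 n3 h1 h2 h3
    rcases h.tot x (by simp [hY]) y (by simp [hY]) nxy with xy | yx
    · exact fin x y r' s' t' rfl hB' nxy n1 n2 n3 xy h1 h2 h3
    · exact fin y x r' s' t' (Finset.pair_comm _ _) hB' nxy.symm n1 n2 n3 yx h1 h2 h3
  have ru := hRB r (by simp)
  have su := hRB s (by simp)
  have tu := hRB t (by simp)
  have rY : r ∈ Y := by simp [hY]
  have sY : s ∈ Y := by simp [hY]
  have tY : t ∈ Y := by simp [hY]
  rcases h.tot r rY s sY nrs with h1 | h1 <;> rcases h.tot s sY t tY nst with h2 | h2 <;>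
    rcases h.tot r rY t tY nrt with h3 | h3
  · exact fin2 r s t rfl nrs nrt nst h1 h2 h3
  · exact (h.tin u r s t ru su tu h1 h2 h3).elim
  · exact fin2 r t s (by ext; simp; grind) nrt nrs nst.symm h3 h2 h1
  · exact fin2 t r s (by ext; simp; grind) nrt.symm nst.symm nrs h3 h1 h2
  · exact fin2 s r t (by ext; simp; grind) nrs.symm nst nrt h1 h3 h2
  · exact fin2 s t r (by ext; simp; grind) nst nrs.symm nrt.symm h2 h3 h1
  · exact (h.tin u r t s ru tu su h3 h2 h1).elim
  · exact fin2 t s r (by ext; simp; grind) nst.symm nrt.symm nrs.symm h2 h1 h3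

lemma Tour.main (h : Tour Y R) (hc : Y.card = 6) :
    ∃ a b c d e f, Y = {a, b, c, d, e, f} ∧ [a, b, c, d, e, f].Nodup ∧
      R a b ∧ R b c ∧ R c a ∧ R d e ∧ R e f ∧ R f d := by
  classical
  obtain ⟨u, hu⟩ : Y.Nonempty := Finset.card_pos.1 (by omega)
  set A := Y.filter (fun x => R u x) with hAdef
  set B := Y.filter (fun x => R x u) with hBdef
  have irr : ¬ R u u := fun hh => h.asym u u hh hh
  have huA : u ∉ A := by simp [A, irr]
  have huB : u ∉ B := by simp [B, irr]
  have hAB : Disjoint A B := by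
    rw [Finset.disjoint_left]; intro x hx hx'
    exact h.asym _ _ (Finset.mem_filter.1 hx).2 (Finset.mem_filter.1 hx').2
  have hY : Y = insert u (A ∪ B) := by
    ext x
    simp only [A, B, Finset.mem_insert, Finset.mem_union, Finset.mem_filter]
    constructor
    · intro hx
      by_cases hxu : x = u
      · exact Or.inl hxu
      · rcases h.tot x hx u hu hxu with h1 | h1 <;> tauto
    · rintro (rfl | h1 | h1) <;> tauto
  have hcard : A.card + B.card = 5 := by
    have := congrArg Finset.card hY
    rw [Finset.card_insert_of_notMem (by simp [huA, huB]), Finset.card_union_of_disjoint hAB] at this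
    omega
  have hA3 : A.card ≤ 3 := by
    by_contra hcon
    obtain ⟨T, hT, hT4⟩ := Finset.exists_subset_card_eq (show 4 ≤ A.card by omega)
    exact h.hout u hu T (hT.trans (Finset.filter_subset _ _)) hT4
      (fun x hx => (Finset.mem_filter.1 (hT hx)).2)
  have hB3 : B.card ≤ 3 := by
    by_contra hcon
    obtain ⟨T, hT, hT4⟩ := Finset.exists_subset_card_eq (show 4 ≤ B.card by omega)
    exact h.hin u hu T (hT.trans (Finset.filter_subset _ _)) hT4
      (fun x hx => (Finset.mem_filter.1 (hT hx)).2)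
  have hRA : ∀ x ∈ A, R u x := fun x hx => (Finset.mem_filter.1 hx).2
  have hRB : ∀ x ∈ B, R x u := fun x hx => (Finset.mem_filter.1 hx).2
  rcases (show A.card = 2 ∨ A.card = 3 by omega) with h2 | h3
  · exact h.aux hu h2 (by omega) hY huA huB hAB hRA hRB
  · obtain ⟨a, b, c, d, e, f, h0, hn, h1, h2, h3, h4, h5, h6⟩ :=
      h.flip.aux hu (A := B) (B := A) (by omega) h3 (by rw [Finset.union_comm]; exact hY)
        huB huA hAB.symm hRB hRA
    refine ⟨a, c, b, d, f, e, ?_, ?_, h3, h2, h1, h6, h5, h4⟩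
    · rw [h0]; ext w; simp; grind
    · simp at hn ⊢; grind

end Tournament

lemma D_swap (z u v : E2) : D z u v = - D z v u := by simp only [D]; ring

set_option maxHeartbeats 2000000 in
/-- No point of `X` in the center region if there are no Type I partitions. -/
lemma typeI {X : Finset E2} (hX : GP X) {z : E2} (hz : z ∈ X) (hzC : z ∈ C X) :
    ∃ P, IsTverbergPartition 2 3 X P ∧ z ∈ ⋂ S ∈ P, convexHull ℝ (S : Set E2) := by
  classical
  have deg : ∀ (ε : ℝ), ε ≠ 0 → ∀ u ∈ X.erase z, ∀ T ⊆ X.erase z, T.card = 4 → 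
      (∀ x ∈ T, 0 < ε * D z u x) → False := by
    intro ε hε u hu T hT hT4 hpos
    obtain ⟨huz, huX⟩ := Finset.mem_erase.1 hu
    have huT : u ∉ T := by
      intro hh
      have := hpos u hh
      have h0 : D z u u = 0 := by simp only [D]; ring
      rw [h0] at this; simp at this
    have hS := hzC (insert u T)
      (Finset.insert_subset huX (hT.trans (Finset.erase_subset _ _)))
      (by rw [Finset.card_insert_of_notMem huT, hT4])
    have huu : L z u u = L z u z := by simp only [L_apply]; ring
    have hTD : ∀ x ∈ T, (-ε • L z u) x < (-ε • L z u) z := by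
      intro x hx
      have := hpos x hx
      rw [D_eq] at this
      simp only [LinearMap.smul_apply, smul_eq_mul]
      linarith
    have := face (-ε • L z u) hS (by
      intro x hx
      rcases Finset.mem_insert.1 hx with rfl | hx
      · simp only [LinearMap.smul_apply, huu]; exact le_rfl
      · exact (hTD x hx).le)
    have hsub : ((insert u T).filter (fun x => (-ε • L z u) x = (-ε • L z u) z)) ⊆ {u} := by
      intro x hx
      obtain ⟨h1, h2⟩ := Finset.mem_filter.1 hx
      rcases Finset.mem_insert.1 h1 with rfl | h1
      · simp
      · exact absurd h2 (hTD x h1).ne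
    have h3 := convexHull_mono (𝕜 := ℝ) (Finset.coe_subset.2 hsub) this
    simp at h3
    exact huz h3.symm
  have T : Tour (X.erase z) (fun u v => 0 < D z u v) :=
    { tot := by
        intro x hx y hy hxy
        obtain ⟨h1, h2⟩ := Finset.mem_erase.1 hx
        obtain ⟨h3, h4⟩ := Finset.mem_erase.1 hy
        have := hX.coll z hz x h2 y h4 h1.symm h3.symm hxy
        rw [D_swap z y x]
        rcases lt_or_gt_of_ne this with h | h
        · right; linarith
        · left; exact h
      asym := by
        intro x y h1 h2
        rw [D_swap] at h2; linarith
      hout := by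
        intro u hu T hT h4 hx
        exact deg 1 one_ne_zero u hu T hT h4 (by simpa using hx)
      hin := by
        intro u hu T hT h4 hx
        refine deg (-1) (by norm_num) u hu T hT h4 ?_
        intro x hxT
        have := hx x hxT
        rw [D_swap] at this
        linarith
      tout := by
        intro r a b c h1 h2 h3 h4 h5 h6
        have : D z a b * D z r c + D z b c * D z r a + D z c a * D z r b = 0 := by
          simp only [D]; ring
        have := mul_pos h4 h3
        have := mul_pos h5 h1
        have := mul_pos h6 h2
        linarith
      tin := by
        intro r a b c h1 h2 h3 h4 h5 h6
        have : D z a b * D z c r + D z b c * D z a r + D z c a * D z b r = 0 := by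
          simp only [D]; ring
        have := mul_pos h4 h3
        have := mul_pos h5 h1
        have := mul_pos h6 h2
        linarith }
  obtain ⟨a, b, c, d, e, f, hY, hn, h1, h2, h3, h4, h5, h6⟩ :=
    T.main (by rw [Finset.card_erase_of_mem hz, hX.card])
  have tri : ∀ u v w : E2, 0 < D z u v → 0 < D z v w → 0 < D z w u → 
      z ∈ convexHull ℝ (({u, v, w} : Finset E2) : Set E2) := by
    intro u v w h1 h2 h3
    have hsum : D z v w + D z w u + D z u v = D u v w := by simp only [D]; ring
    exact mem_tri (convex_convexHull ℝ _) (subset_convexHull _ _ (by simp))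
      (subset_convexHull _ _ (by simp)) (subset_convexHull _ _ (by simp)) h1.le h2.le h3.le
      (by linarith)
  have hzY : z ∉ ({a, b, c, d, e, f} : Finset E2) := by rw [← hY]; simp
  have := mk_partition (X := X) (S₁ := {z}) (S₂ := {a, b, c}) (S₃ := {d, e, f}) (y := z)
    (by
      rw [← Finset.insert_erase hz, hY]; ext w; simp; grind)
    (by simp at hzY ⊢; grind) (by simp at hzY ⊢; tauto)
    (by simp at hn ⊢; grind) (by simp) (tri a b c h1 h2 h3) (tri d e f h4 h5 h6)
  exact ⟨_, this⟩

end Tv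

namespace Tv
open Filter Topology

lemma interior_nonempty {S : Finset E2} {a b c : E2} (ha : a ∈ S) (hb : b ∈ S) (hc : c ∈ S)
    (h : D a b c ≠ 0) : (interior (convexHull ℝ (S : Set E2))).Nonempty := by
  rw [interior_convexHull_nonempty_iff_affineSpan_eq_top]
  have hnc : ¬ Collinear ℝ ({a, b, c} : Set E2) := by
    intro hcol
    rw [collinear_iff_of_mem (p₀ := a) (by simp)] at hcol
    obtain ⟨v, hv⟩ := hcol
    obtain ⟨r, hr⟩ := hv b (by simp)
    obtain ⟨s, hs⟩ := hv c (by simp)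
    apply h
    rw [hr, hs]; simp [D]; ring
  have hai := affineIndependent_iff_not_collinear_set.2 hnc
  have htop := hai.affineSpan_eq_top_iff_card_eq_finrank_add_one.2 (by simp)
  rw [eq_top_iff, ← htop]
  apply affineSpan_mono
  rintro x ⟨i, rfl⟩
  fin_cases i <;> simpa

lemma lin_coord (f : E2 →ₗ[ℝ] ℝ) : ∃ f0 f1 : ℝ, ∀ x : E2, f x = f0 * x 0 + f1 * x 1 := by
  refine ⟨f (EuclideanSpace.single 0 1), f (EuclideanSpace.single 1 1), fun x => ?_⟩
  have : x = x 0 • EuclideanSpace.single 0 1 + x 1 • EuclideanSpace.single 1 1 := by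
    ext i; fin_cases i <;> simp
  conv_lhs => rw [this]
  rw [map_add, map_smul, map_smul]; simp; ring

lemma D_swap12 (a b x : E2) : D b a x = - D a b x := by simp only [D]; ring

lemma ext_coord {a b : E2} (h0 : a 0 = b 0) (h1 : a 1 = b 1) : a = b := by
  ext i; fin_cases i <;> simpa

lemma frontier_pair {X S : Finset E2} (hX : GP X) (hSX : S ⊆ X) (hS5 : S.card = 5) {p : E2}
    (hp : p ∈ convexHull ℝ (S : Set E2)) (hpX : p ∉ X)
    (hpi : p ∉ interior (convexHull ℝ (S : Set E2))) :
    ∃ a ∈ S, ∃ b ∈ S, a ≠ b ∧ p ∈ openSegment ℝ a b ∧ ∀ x ∈ S, 0 ≤ D a b x := by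
  classical
  obtain ⟨a, b, c, ha, hb, hc, hab, hac, hbc⟩ := Finset.two_lt_card_iff.1 (show 2 < S.card by omega)
  have hinn := interior_nonempty ha hb hc
    (hX.coll a (hSX ha) b (hSX hb) c (hSX hc) hab hac hbc)
  clear ha hb hc hab hac hbc a b c
  obtain ⟨f, hf0, hf⟩ := geometric_hahn_banach_of_nonempty_interior_point
    (convex_convexHull ℝ (S : Set E2)) hpi hinn
  have hfS : ∀ x ∈ S, (f : E2 →ₗ[ℝ] ℝ) x ≤ (f : E2 →ₗ[ℝ] ℝ) p :=
    fun x hx => hf x (subset_convexHull _ _ hx)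
  have hF := face (f : E2 →ₗ[ℝ] ℝ) hp hfS
  obtain ⟨f0, f1, hfc⟩ := lin_coord (f : E2 →ₗ[ℝ] ℝ)
  have hne : ¬ (f0 = 0 ∧ f1 = 0) := by
    rintro ⟨rfl, rfl⟩
    apply hf0
    ext x
    have := hfc x
    simpa using this
  generalize (f : E2 →ₗ[ℝ] ℝ) = g at hfS hF hfc
  set F := S.filter (fun x => g x = g p) with hFdef
  have hFS : ∀ x ∈ F, x ∈ S ∧ g x = g p := fun x hx => Finset.mem_filter.1 hx
  have hFle : F.card ≤ 2 := by
    by_contra hcon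
    obtain ⟨a, b, c, ha, hb, hc, hab, hac, hbc⟩ :=
      Finset.two_lt_card_iff.1 (show 2 < F.card by omega)
    refine hX.coll a (hSX (hFS a ha).1) b (hSX (hFS b hb).1) c (hSX (hFS c hc).1) hab hac hbc ?_
    have h1 := (hFS a ha).2
    have h2 := (hFS b hb).2
    have h3 := (hFS c hc).2
    rw [hfc] at h1 h2 h3
    have e0 : f0 * D a b c = 0 := by
      simp only [D]
      linear_combination (c 1 - a 1) * (h2 - h1) - (b 1 - a 1) * (h3 - h1)
    have e1 : f1 * D a b c = 0 := by
      simp only [D]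
      linear_combination (b 0 - a 0) * (h3 - h1) - (c 0 - a 0) * (h2 - h1)
    by_contra hD
    exact hne ⟨(mul_eq_zero.1 e0).resolve_right hD, (mul_eq_zero.1 e1).resolve_right hD⟩
  have hF0 : F.card ≠ 0 := by
    intro h
    rw [Finset.card_eq_zero.1 h] at hF
    simp at hF
  have hF1 : F.card ≠ 1 := by
    intro h
    obtain ⟨x, hx⟩ := Finset.card_eq_one.1 h
    rw [hx] at hF
    simp at hF
    apply hpX
    rw [hF]
    exact hSX (hFS x (by simp [hx])).1
  obtain ⟨a, b, hab, hFab⟩ := Finset.card_eq_two.1 (show F.card = 2 by omega)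
  obtain ⟨ha, hga⟩ := hFS a (by simp [hFab])
  obtain ⟨hb, hgb⟩ := hFS b (by simp [hFab])
  rw [hFab] at hF
  have hseg : p ∈ segment ℝ a b := by
    rw [← convexHull_pair]; simpa using hF
  have hop : p ∈ openSegment ℝ a b := mem_openSegment_of_ne_left_right
    (by rintro rfl; exact hpX (hSX ha)) (by rintro rfl; exact hpX (hSX hb)) hseg
  rw [hfc] at hga hgb
  obtain ⟨k, hk0, hk1⟩ : ∃ k : ℝ, f0 = - k * (b 1 - a 1) ∧ f1 = k * (b 0 - a 0) := by
    by_cases h : b 0 - a 0 = 0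
    · have h' : b 1 - a 1 ≠ 0 := by
        intro h'
        exact hab (ext_coord (by linarith) (by linarith))
      refine ⟨- f0 / (b 1 - a 1), by field_simp, ?_⟩
      have : f1 * (b 1 - a 1) = 0 := by linear_combination hgb - hga - f0 * h
      rw [h, (mul_eq_zero.1 this).resolve_right h']; ring
    · refine ⟨f1 / (b 0 - a 0), ?_, by field_simp⟩
      field_simp
      linear_combination hgb - hga
  have hD : ∀ x ∈ S, k * D a b x ≤ 0 := by
    intro x hx
    have h1 := hfS x hx
    rw [hfc] at h1
    have : k * D a b x = f0 * x 0 + f1 * x 1 - g p := by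
      rw [← hga, hk0, hk1]; simp only [D]; ring
    linarith
  have hk : k ≠ 0 := by
    rintro rfl
    exact hne ⟨by rw [hk0]; ring, by rw [hk1]; ring⟩
  rcases lt_or_gt_of_ne hk with hk | hk
  · refine ⟨a, ha, b, hb, hab, hop, fun x hx => ?_⟩
    have := hD x hx
    by_contra hc
    have := mul_pos_of_neg_of_neg hk (not_le.1 hc)
    linarith
  · refine ⟨b, hb, a, ha, hab.symm, by rw [openSegment_symm]; exact hop, fun x hx => ?_⟩
    rw [D_swap12]
    have := hD x hx
    by_contra hc
    have := mul_pos hk (show 0 < D a b x by linarith)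
    linarith

def Maj (X : Finset E2) (a b : E2) : Prop :=
  ∃ S ⊆ X, S.card = 5 ∧ a ∈ S ∧ b ∈ S ∧ ∀ x ∈ S, 0 ≤ D a b x

def Th (X : Finset E2) (p a b : E2) : Prop :=
  a ∈ X ∧ b ∈ X ∧ a ≠ b ∧ p ∈ openSegment ℝ a b

lemma Th.symm {X : Finset E2} {p a b : E2} (h : Th X p a b) : Th X p b a :=
  ⟨h.2.1, h.1, h.2.2.1.symm, by rw [openSegment_symm]; exact h.2.2.2⟩

lemma openSeg_param {p a b : E2} (h : p ∈ openSegment ℝ a b) :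
    ∃ s : ℝ, 0 < s ∧ s < 1 ∧ p 0 = a 0 + s * (b 0 - a 0) ∧ p 1 = a 1 + s * (b 1 - a 1) := by
  obtain ⟨r, s, hr, hs, hrs, rfl⟩ := h
  refine ⟨s, hs, by linarith, ?_, ?_⟩
  · simp; linear_combination (a 0) * hrs
  · simp; linear_combination (a 1) * hrs

lemma Th.D_zero {X : Finset E2} {p a b : E2} (h : Th X p a b) : D a b p = 0 := by
  obtain ⟨s, -, -, h0, h1⟩ := openSeg_param h.2.2.2
  simp only [D, h0, h1]; ring

lemma Th.notMem_ne {X : Finset E2} {p a b : E2} (_h : Th X p a b) (hp : p ∉ X) {x : E2}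
    (hx : x ∈ X) : x ≠ p := by rintro rfl; exact hp hx

/-- value of an affine functional along a segment -/
lemma Th.D_comb {X : Finset E2} {p a b : E2} (h : Th X p a b) (u v : E2) :
    ∃ s : ℝ, 0 < s ∧ s < 1 ∧ D u v p = (1 - s) * D u v a + s * D u v b := by
  obtain ⟨s, hs, hs1, h0, h1⟩ := openSeg_param h.2.2.2
  refine ⟨s, hs, hs1, ?_⟩
  simp only [D, h0, h1]; ring

lemma D_self1 (a b : E2) : D a b a = 0 := by simp only [D]; ring
lemma D_self2 (a b : E2) : D a b b = 0 := by simp only [D]; ring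

lemma maj_or {X : Finset E2} (hX : GP X) {a b : E2} (ha : a ∈ X) (hb : b ∈ X) (hab : a ≠ b) :
    Maj X a b ∨ Maj X b a := by
  classical
  set Q := (X.erase a).erase b
  have hQ : Q.card = 5 := by
    rw [Finset.card_erase_of_mem (by simp [hab.symm, hb]), Finset.card_erase_of_mem ha, hX.card]
  have key : ∀ u v : E2, u ∈ X → v ∈ X → u ≠ v → u ∉ Q → v ∉ Q → 
      3 ≤ (Q.filter (fun x => 0 ≤ D u v x)).card → Maj X u v := by
    intro u v hu hv huv huQ hvQ h3
    obtain ⟨T, hT, hT3⟩ := Finset.exists_subset_card_eq h3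
    have hTQ : T ⊆ Q := hT.trans (Finset.filter_subset _ _)
    refine ⟨insert u (insert v T), ?_, ?_, by simp, by simp, ?_⟩
    · intro x hx
      simp only [Finset.mem_insert] at hx
      rcases hx with rfl | rfl | hx
      · exact hu
      · exact hv
      · exact Finset.mem_of_mem_erase (Finset.mem_of_mem_erase (hTQ hx))
    · rw [Finset.card_insert_of_notMem, Finset.card_insert_of_notMem, hT3]
      · exact fun h => hvQ (hTQ h)
      · simp only [Finset.mem_insert, not_or]
        exact ⟨huv, fun h => huQ (hTQ h)⟩
    · intro x hx
      simp only [Finset.mem_insert] at hx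
      rcases hx with rfl | rfl | hx
      · rw [D_self1]
      · rw [D_self2]
      · exact (Finset.mem_filter.1 (hT hx)).2
  have hsplit := Finset.card_filter_add_card_filter_not (s := Q) (fun x => 0 ≤ D a b x)
  by_cases h3 : 3 ≤ (Q.filter (fun x => 0 ≤ D a b x)).card
  · left; exact key a b ha hb hab (by simp [Q]) (by simp [Q]) h3
  · right
    refine key b a hb ha hab.symm (by simp [Q]) (by simp [Q]) ?_
    have : (Q.filter (fun x => ¬ 0 ≤ D a b x)) ⊆ Q.filter (fun x => 0 ≤ D b a x) := by
      intro x hx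
      rw [Finset.mem_filter] at hx ⊢
      refine ⟨hx.1, ?_⟩
      rw [D_swap12]; linarith [hx.2]
    have := Finset.card_le_card this
    omega

lemma maj_not {X : Finset E2} (hX : GP X) {a b : E2} (hab : a ≠ b) (h1 : Maj X a b)
    (h2 : Maj X b a) : False := by
  classical
  obtain ⟨S, hS, hS5, haS, hbS, hSD⟩ := h1
  obtain ⟨T, hT, hT5, haT, hbT, hTD⟩ := h2
  have hI : S ∩ T ⊆ {a, b} := by
    intro x hx
    obtain ⟨hxS, hxT⟩ := Finset.mem_inter.1 hx
    have h1 := hSD x hxS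
    have h2 := hTD x hxT
    rw [D_swap12] at h2
    by_contra hc
    simp only [Finset.mem_insert, Finset.mem_singleton, not_or] at hc
    exact hX.coll a (hS haS) b (hS hbS) x (hS hxS) hab (Ne.symm hc.1) (Ne.symm hc.2)
      (by linarith)
  have h1 := Finset.card_le_card hI
  rw [Finset.card_pair hab] at h1
  have h2 := Finset.card_le_card (Finset.union_subset hS hT)
  have h3 := Finset.card_union_add_card_inter S T
  have := hX.card
  omega

lemma maj_nonneg {X : Finset E2} {a b q : E2} (h : Maj X a b) (hq : q ∈ C X) : 0 ≤ D a b q := by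
  obtain ⟨S, hS, hS5, haS, hbS, hSD⟩ := h
  have := conv_le (-L a b) (- L a b a) (hq S hS hS5) (by
    intro x hx
    have := hSD x hx
    rw [D_eq] at this
    simp only [LinearMap.neg_apply]; linarith)
  rw [D_eq]; simp only [LinearMap.neg_apply] at this; linarith

lemma maj_seg {X : Finset E2} (hX : GP X) {a b q : E2} (hab : a ≠ b) (h : Maj X a b)
    (hq : q ∈ C X) (h0 : D a b q = 0) : q ∈ segment ℝ a b := by
  classical
  obtain ⟨S, hS, hS5, haS, hbS, hSD⟩ := h
  rw [D_eq] at h0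
  have := face (-L a b) (hq S hS hS5) (by
    intro x hx
    have := hSD x hx
    rw [D_eq] at this
    simp only [LinearMap.neg_apply]; linarith)
  rw [← convexHull_pair]
  refine convexHull_mono ?_ this
  intro x hx
  obtain ⟨h1, h2⟩ := Finset.mem_filter.1 (Finset.mem_coe.1 hx)
  simp only [LinearMap.neg_apply] at h2
  by_contra hc
  simp only [Set.mem_insert_iff, Set.mem_singleton_iff, not_or] at hc
  refine hX.coll a (hS haS) b (hS hbS) x (hS h1) hab (Ne.symm hc.1) (Ne.symm hc.2) ?_
  rw [D_eq]; linarith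

/-- Local structure of the center region. -/
lemma localC {X : Finset E2} (hX : GP X) {p v : E2} (hpC : p ∈ C X) (hpX : p ∉ X)
    (hv : ∀ a b, Maj X a b → Th X p a b → 0 ≤ D a b (p + v)) :
    ∀ᶠ t : ℝ in 𝓝[>] 0, p + t • v ∈ C X := by
  rw [C_eq]
  simp only [Set.mem_iInter]
  rw [Finset.eventually_all]
  intro S hS
  obtain ⟨hSX, hS5⟩ := Finset.mem_powersetCard.1 hS
  have hpS := hpC S hSX hS5
  by_cases hpi : p ∈ interior (convexHull ℝ (S : Set E2))
  · have hcont : Tendsto (fun t : ℝ => p + t • v) (𝓝[>] 0) (𝓝 p) := by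
      have : Tendsto (fun t : ℝ => p + t • v) (𝓝 0) (𝓝 (p + (0:ℝ) • v)) :=
        Continuous.tendsto (by fun_prop) 0
      rw [zero_smul, add_zero] at this
      exact this.mono_left nhdsWithin_le_nhds
    exact hcont.eventually (mem_interior_iff_mem_nhds.1 hpi)
  · obtain ⟨a, ha, b, hb, hab, hpab, hSD⟩ := frontier_pair hX hSX hS5 hpS hpX hpi
    have hT : Th X p a b := ⟨hSX ha, hSX hb, hab, hpab⟩
    have hv' := hv a b ⟨S, hSX, hS5, ha, hb, hSD⟩ hT
    obtain ⟨s, hs, hsa, hsb⟩ : ∃ s ∈ S, s ≠ a ∧ s ≠ b := by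
      classical
      obtain ⟨s, hs, hsn⟩ := Finset.exists_mem_notMem_of_card_lt_card
        (show ({a, b} : Finset E2).card < S.card by rw [Finset.card_pair hab]; omega)
      simp at hsn; exact ⟨s, hs, hsn⟩
    have hsD : 0 < D a b s := lt_of_le_of_ne (hSD s hs)
      (Ne.symm (hX.coll a (hSX ha) b (hSX hb) s (hSX hs) hab hsa.symm hsb.symm))
    obtain ⟨r, hr, hr1, h0, h1⟩ := openSeg_param hpab
    have e1 : D p b s = (1 - r) * D a b s := by simp only [D, h0, h1]; ring
    have e2 : D p s a = r * D a b s := by simp only [D, h0, h1]; ring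
    have c1 : ∀ᶠ t : ℝ in 𝓝[>] 0, 0 < D (p + t • v) b s := by
      have : Tendsto (fun t : ℝ => D (p + t • v) b s) (𝓝 0) (𝓝 (D (p + (0:ℝ) • v) b s)) :=
        Continuous.tendsto (by simp only [D, PiLp.add_apply, PiLp.smul_apply]; fun_prop) 0
      rw [zero_smul, add_zero] at this
      refine (this.mono_left nhdsWithin_le_nhds).eventually (lt_mem_nhds ?_)
      rw [e1]; exact mul_pos (by linarith) hsD
    have c2 : ∀ᶠ t : ℝ in 𝓝[>] 0, 0 < D (p + t • v) s a := by
      have : Tendsto (fun t : ℝ => D (p + t • v) s a) (𝓝 0) (𝓝 (D (p + (0:ℝ) • v) s a)) :=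
        Continuous.tendsto (by simp only [D, PiLp.add_apply, PiLp.smul_apply]; fun_prop) 0
      rw [zero_smul, add_zero] at this
      refine (this.mono_left nhdsWithin_le_nhds).eventually (lt_mem_nhds ?_)
      rw [e2]; exact mul_pos (by linarith) hsD
    filter_upwards [c1, c2, self_mem_nhdsWithin] with t ht1 ht2 ht0
    have ht0 : 0 < t := ht0
    refine mem_tri (convex_convexHull ℝ _) (subset_convexHull _ _ ha) (subset_convexHull _ _ hb)
      (subset_convexHull _ _ hs) ?_ ht1.le ht2.le hsD
    have : D (p + t • v) a b = t * D a b (p + v) + (1 - t) * D a b p := by simp [D]; ring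
    rw [this, hT.D_zero]
    have := mul_nonneg ht0.le hv'
    linarith

lemma Th.share {X : Finset E2} (hX : GP X) {p a b d : E2} (h1 : Th X p a b) (h2 : Th X p a d) :
    b = d := by
  by_contra hbd
  obtain ⟨s, hs, hs1, h⟩ := h2.D_comb a b
  rw [h1.D_zero, D_self1] at h
  refine hX.coll a h1.1 b h1.2.1 d h2.2.1 h1.2.2.1 h2.2.2.1 hbd ?_
  have : s * D a b d = 0 := by linarith
  exact (mul_eq_zero.1 this).resolve_left hs.ne'

lemma Th.disj {X : Finset E2} (hX : GP X) {p a b c d : E2} (h1 : Th X p a b) (h2 : Th X p c d) :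
    [a, b, c, d].Nodup ∨ (a = c ∧ b = d) ∨ (a = d ∧ b = c) := by
  have hab := h1.2.2.1
  have hcd := h2.2.2.1
  by_cases h : a = c
  · subst h; right; left; exact ⟨rfl, h1.share hX h2⟩
  by_cases h' : a = d
  · subst h'; right; right; exact ⟨rfl, h1.share hX h2.symm⟩
  by_cases h3 : b = c
  · subst h3; exact absurd (h1.symm.share hX h2) h'
  by_cases h4 : b = d
  · subst h4; exact absurd (h1.symm.share hX h2.symm) h
  left; simp; tauto

lemma Th.third {X : Finset E2} (hX : GP X) {p a b c d e f : E2} (h1 : Th X p a b)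
    (h2 : Th X p c d) (hn : [a, b, c, d].Nodup) (h3 : Th X p e f) :
    ((a = e ∧ b = f) ∨ (a = f ∧ b = e)) ∨ ((c = e ∧ d = f) ∨ (c = f ∧ d = e)) := by
  rcases h1.disj hX h3 with h | h
  · rcases h2.disj hX h3 with h' | h'
    · exfalso
      exact hX.conc a h1.1 b h1.2.1 c h2.1 d h2.2.1 e h3.1 f h3.2.1
        (by simp at hn h h' ⊢; tauto) p h1.D_zero h2.D_zero h3.D_zero
    · right; exact h'
  · left; exact h

/-- two distinct lines meet in at most one point -/
lemma Th.unique {X : Finset E2} (hX : GP X) {p q a b c d : E2} (h1 : Th X p a b)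
    (h2 : Th X p c d) (hn : [a, b, c, d].Nodup) (k1 : D a b q = 0) (k2 : D c d q = 0) :
    q = p := by
  have k1' := h1.D_zero
  have k2' := h2.D_zero
  have hnz : (b 0 - a 0) * (d 1 - c 1) - (b 1 - a 1) * (d 0 - c 0) ≠ 0 := by
    intro h0
    obtain ⟨s, hs, hs1, hh⟩ := h2.D_comb a b
    have e : D a b d - D a b c = 0 := by simp only [D]; linarith
    have : D a b c = 0 := by rw [k1'] at hh; linear_combination -hh - s * e
    simp at hn
    exact hX.coll a h1.1 b h1.2.1 c h2.1 (by tauto) (by tauto) (by tauto) this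
  simp only [D] at k1 k2 k1' k2'
  apply ext_coord
  · have : (q 0 - p 0) * ((b 0 - a 0) * (d 1 - c 1) - (b 1 - a 1) * (d 0 - c 0)) = 0 := by
      linear_combination (d 0 - c 0) * (k1 - k1') - (b 0 - a 0) * (k2 - k2')
    have := (mul_eq_zero.1 this).resolve_right hnz
    linarith
  · have : (q 1 - p 1) * ((b 0 - a 0) * (d 1 - c 1) - (b 1 - a 1) * (d 0 - c 0)) = 0 := by
      linear_combination (d 1 - c 1) * (k1 - k1') - (b 1 - a 1) * (k2 - k2')
    have := (mul_eq_zero.1 this).resolve_right hnz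
    linarith

end Tv

namespace Tv
open Filter Topology

/-- extreme points of the center region -/
def Ext (X : Finset E2) : Set E2 := (C X).extremePoints ℝ

lemma ext_not_line {X : Finset E2} (hX : GP X) {p v : E2} (hp : p ∈ Ext X) (hpX : p ∉ X)
    (hv0 : v ≠ 0) (hv : ∀ a b, Maj X a b → Th X p a b → D a b (p + v) = 0) : False := by
  have h1 := localC hX (v := v) hp.1 hpX (fun a b hM hT => (hv a b hM hT).ge)
  have h2 := localC hX (v := -v) hp.1 hpX (fun a b hM hT => by
    have e := hv a b hM hT
    have e0 := hT.D_zero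
    have : D a b (p + -v) = 2 * D a b p - D a b (p + v) := by simp [D]; ring
    rw [this, e, e0]; simp)
  obtain ⟨t, ⟨ht1, ht2⟩, ht0⟩ := ((h1.and h2).and self_mem_nhdsWithin).exists
  have ht0 : 0 < t := ht0
  have := hp.2 ht1 ht2 ⟨1 / 2, 1 / 2, by norm_num, by norm_num, by norm_num, by
    ext i; simp; ring⟩
  have h3 : t • v = 0 := by simpa using this
  rcases smul_eq_zero.1 h3 with h | h
  · exact ht0.ne' h
  · exact hv0 h

lemma ext_other {X : Finset E2} (hX : GP X) {p a b : E2} (hp : p ∈ Ext X) (hpX : p ∉ X)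
    (h1 : Th X p a b) : ∃ c d, Maj X c d ∧ Th X p c d ∧ [a, b, c, d].Nodup := by
  by_contra hcon
  push Not at hcon
  refine ext_not_line hX hp hpX (v := b - a) (sub_ne_zero.2 h1.2.2.1.symm) ?_
  intro c d hM hT
  have h0 := h1.D_zero
  rcases h1.disj hX hT with h | ⟨rfl, rfl⟩ | ⟨rfl, rfl⟩
  · exact absurd h (hcon c d hM hT)
  · have : D a b (p + (b - a)) = D a b p := by simp [D]; ring
    rw [this, h0]
  · have : D b a (p + (b - a)) = - D a b p := by simp [D]; ring
    rw [this, h0]; simp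

lemma ext_some {X : Finset E2} (hX : GP X) {p : E2} (hp : p ∈ Ext X) (hpX : p ∉ X) :
    ∃ a b, Th X p a b := by
  by_contra hcon
  push Not at hcon
  refine ext_not_line hX hp hpX (v := EuclideanSpace.single 0 1) (by simp) ?_
  intro c d _ hT
  exact absurd hT (hcon c d)

lemma ext_adj_maj {X : Finset E2} (hX : GP X) (hCX : ∀ x ∈ C X, x ∉ X) {p a b : E2}
    (hp : p ∈ Ext X) (h1 : Th X p a b) (hM : Maj X a b) :
    ∃ q ∈ Ext X, q ≠ p ∧ Th X q a b := by
  obtain ⟨c, d, hMcd, h2, hn⟩ := ext_other hX hp (hCX p hp.1) h1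
  set k := D c d b - D c d a with hk
  have hk0 : k ≠ 0 := by
    intro h0
    obtain ⟨s, hs, hs1, hh⟩ := h1.D_comb c d
    rw [h2.D_zero] at hh
    have : D c d a = 0 := by linear_combination -hh - s * h0 + s * hk
    simp at hn
    exact hX.coll c h2.1 d h2.2.1 a h1.1 (by tauto) (by tauto) (by tauto) this
  have hloc := localC hX (v := k • (b - a)) hp.1 (hCX p hp.1) (by
    intro e f hMef h3
    have z1 := h1.D_zero
    have z2 := h2.D_zero
    rcases h1.third hX h2 hn h3 with (⟨rfl, rfl⟩ | ⟨rfl, rfl⟩) | (⟨rfl, rfl⟩ | ⟨rfl, rfl⟩)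
    · have : D a b (p + k • (b - a)) = D a b p := by simp [D]; ring
      rw [this, z1]
    · have : D b a (p + k • (b - a)) = - D a b p := by simp [D]; ring
      rw [this, z1]; simp
    · have : D c d (p + k • (b - a)) = D c d p + k * (D c d b - D c d a) := by simp [D]; ring
      rw [this, z2, ← hk]; nlinarith [mul_self_nonneg k]
    · exact (maj_not hX h2.2.2.1 hMcd hMef).elim)
  obtain ⟨t, ht1, ht0⟩ := (hloc.and self_mem_nhdsWithin).exists
  have ht0 : 0 < t := ht0
  let l : E2 → ℝ := fun x => k * ((b 0 - a 0) * x 0 + (b 1 - a 1) * x 1)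
  have hl : Continuous l := by simp only [l]; fun_prop
  have hDc : Continuous (fun x => D a b x) := by simp only [D]; fun_prop
  have hK : IsCompact (C X ∩ {x | D a b x = 0}) :=
    (C_compact hX).inter_right (isClosed_eq hDc continuous_const)
  have hq0 : D a b (p + t • (k • (b - a))) = 0 := by
    have : D a b (p + t • (k • (b - a))) = D a b p := by simp [D]; ring
    rw [this, h1.D_zero]
  obtain ⟨m, ⟨hmC, hm0⟩, hmax⟩ := hK.exists_isMaxOn ⟨_, ht1, hq0⟩ hl.continuousOn
  have hm0 : D a b m = 0 := hm0
  have hmax' : ∀ x ∈ C X, D a b x = 0 → l x ≤ l m := fun x hx hx0 => hmax ⟨hx, hx0⟩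
  have hsq : 0 < (b 0 - a 0) ^ 2 + (b 1 - a 1) ^ 2 := by
    by_contra hc
    have e0 : (b 0 - a 0) ^ 2 = 0 := by nlinarith [sq_nonneg (b 0 - a 0), sq_nonneg (b 1 - a 1)]
    have e1 : (b 1 - a 1) ^ 2 = 0 := by nlinarith [sq_nonneg (b 0 - a 0), sq_nonneg (b 1 - a 1)]
    have e0 := pow_eq_zero_iff (two_ne_zero) |>.1 e0
    have e1 := pow_eq_zero_iff (two_ne_zero) |>.1 e1
    exact h1.2.2.1 (ext_coord (by linarith) (by linarith))
  have hinj : ∀ x, D a b x = 0 → l x = l m → x = m := by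
    intro x hx0 hxl
    have hxl : (b 0 - a 0) * x 0 + (b 1 - a 1) * x 1 = (b 0 - a 0) * m 0 + (b 1 - a 1) * m 1 :=
      mul_left_cancel₀ hk0 hxl
    simp only [D] at hx0 hm0
    apply ext_coord
    · have : (x 0 - m 0) * ((b 0 - a 0) ^ 2 + (b 1 - a 1) ^ 2) = 0 := by
        linear_combination (b 0 - a 0) * hxl - (b 1 - a 1) * (hx0 - hm0)
      have := (mul_eq_zero.1 this).resolve_right hsq.ne'
      linarith
    · have : (x 1 - m 1) * ((b 0 - a 0) ^ 2 + (b 1 - a 1) ^ 2) = 0 := by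
        linear_combination (b 1 - a 1) * hxl + (b 0 - a 0) * (hx0 - hm0)
      have := (mul_eq_zero.1 this).resolve_right hsq.ne'
      linarith
  have hmX := hCX m hmC
  refine ⟨m, ⟨hmC, ?_⟩, ?_, h1.1, h1.2.1, h1.2.2.1, ?_⟩
  · intro x hx y hy hxy
    obtain ⟨s, hs, hs1, e0, e1⟩ := openSeg_param hxy
    have hx' := maj_nonneg hM hx
    have hy' := maj_nonneg hM hy
    have hcomb : D a b m = (1 - s) * D a b x + s * D a b y := by
      simp only [D, e0, e1]; ring
    rw [hm0] at hcomb
    have p1 := mul_nonneg (show 0 ≤ 1 - s by linarith) hx'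
    have p2 := mul_nonneg hs.le hy'
    have hx0 : D a b x = 0 :=
      (mul_eq_zero.1 (show (1 - s) * D a b x = 0 by linarith)).resolve_left (by linarith)
    have hy0 : D a b y = 0 :=
      (mul_eq_zero.1 (show s * D a b y = 0 by linarith)).resolve_left (by linarith)
    have lx := hmax' x hx hx0
    have ly := hmax' y hy hy0
    have lc : l m = (1 - s) * l x + s * l y := by
      simp only [l, e0, e1]; ring
    refine hinj x hx0 (le_antisymm lx ?_)
    have : 0 ≤ s * (l m - l y) := mul_nonneg hs.le (by linarith)
    have h3 : (1 - s) * (l m - l x) ≤ 0 := by linarith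
    by_contra hc
    have := mul_pos (show 0 < 1 - s by linarith) (show 0 < l m - l x by linarith)
    linarith
  · rintro rfl
    have := hmax' _ ht1 hq0
    have e : l (m + t • (k • (b - a))) =
        l m + t * (k ^ 2 * ((b 0 - a 0) ^ 2 + (b 1 - a 1) ^ 2)) := by
      simp [l]; ring
    have : 0 < t * (k ^ 2 * ((b 0 - a 0) ^ 2 + (b 1 - a 1) ^ 2)) := by positivity
    linarith
  · exact mem_openSegment_of_ne_left_right (by rintro rfl; exact hmX h1.1)
      (by rintro rfl; exact hmX h1.2.1) (maj_seg hX h1.2.2.1 hM hmC hm0)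

lemma ext_adj {X : Finset E2} (hX : GP X) (hCX : ∀ x ∈ C X, x ∉ X) {p a b : E2}
    (hp : p ∈ Ext X) (h1 : Th X p a b) :
    ∃ q ∈ Ext X, q ≠ p ∧ Th X q a b := by
  rcases maj_or hX h1.1 h1.2.1 h1.2.2.1 with hM | hM
  · exact ext_adj_maj hX hCX hp h1 hM
  · obtain ⟨q, hq, hne, hT⟩ := ext_adj_maj hX hCX hp h1.symm hM
    exact ⟨q, hq, hne, hT.symm⟩

/-- each extreme point is the unique Tverberg point of a Tverberg partition -/
lemma ext_tverberg {X : Finset E2} (hX : GP X) (hCX : ∀ x ∈ C X, x ∉ X) {p : E2}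
    (hp : p ∈ Ext X) : ∃ P, IsTverbergPartition 2 3 X P ∧
      p ∈ (⋂ S ∈ P, convexHull ℝ (S : Set E2)) ∧
      ∀ q ∈ ⋂ S ∈ P, convexHull ℝ (S : Set E2), q = p := by
  classical
  have hpX := hCX p hp.1
  obtain ⟨a, b, h1⟩ := ext_some hX hp hpX
  obtain ⟨c, d, -, h2, hn⟩ := ext_other hX hp hpX h1
  set W : Finset E2 := X \ {a, b, c, d} with hW
  have h4X : ({a, b, c, d} : Finset E2) ⊆ X := by
    intro x hx
    simp only [Finset.mem_insert, Finset.mem_singleton] at hx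
    rcases hx with rfl | rfl | rfl | rfl
    exacts [h1.1, h1.2.1, h2.1, h2.2.1]
  have hW3 : W.card = 3 := by
    rw [hW, Finset.card_sdiff_of_subset h4X, hX.card, card4 hn]
  have hpab : p ∈ segment ℝ a b := openSegment_subset_segment ℝ _ _ h1.2.2.2
  have hpcd : p ∈ segment ℝ c d := openSegment_subset_segment ℝ _ _ h2.2.2.2
  have hpW : p ∈ convexHull ℝ (W : Set E2) := by
    by_contra hcon
    obtain ⟨g, u, hgu, hg⟩ := geometric_hahn_banach_point_closed
      (convex_convexHull ℝ (W : Set E2)) (W.finite_toSet.isClosed_convexHull ℝ) hcon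
    have pick : ∀ x y, Th X p x y → g p ≤ g x ∨ g p ≤ g y := by
      intro x y h
      by_contra hc
      push Not at hc
      obtain ⟨r, s, hr, hs, hrs, hpe⟩ := h.2.2.2
      have : g p = r * g x + s * g y := by rw [← hpe]; simp
      have e : r * g p + s * g p = g p := by rw [← add_mul, hrs, one_mul]
      have e1 := mul_lt_mul_of_pos_left hc.1 hr
      have e2 := mul_lt_mul_of_pos_left hc.2 hs
      linarith
    have key : ∀ x y z w, Th X p x y → Th X p z w → [x, y, z, w].Nodup → x ∉ W → z ∉ W →
        g p ≤ g x → g p ≤ g z → False := by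
      intro x y z w hxy hzw hn' hxW hzW hgx hgz
      have hn'' : (x ≠ y ∧ x ≠ z ∧ x ≠ w) ∧ (y ≠ z ∧ y ≠ w) ∧ z ≠ w := by simpa using hn'
      have hS := hp.1 (insert x (insert z W)) (by
          intro v hv
          simp only [Finset.mem_insert] at hv
          rcases hv with rfl | rfl | hv
          · exact hxy.1
          · exact hzw.1
          · exact (Finset.mem_sdiff.1 hv).1)
        (by
          rw [Finset.card_insert_of_notMem, Finset.card_insert_of_notMem hzW, hW3]
          simp [hxW, hn''.1.2.1])
      have hgW : ∀ v ∈ W, g p < g v := fun v hv => hgu.trans (hg v (subset_convexHull _ _ hv))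
      have hf := face (-(g : E2 →ₗ[ℝ] ℝ)) hS (by
        intro v hv
        simp only [LinearMap.neg_apply, neg_le_neg_iff, ContinuousLinearMap.coe_coe]
        simp only [Finset.mem_insert] at hv
        rcases hv with rfl | rfl | hv
        · exact hgx
        · exact hgz
        · exact (hgW v hv).le)
      have hseg : p ∈ segment ℝ x z := by
        rw [← convexHull_pair]
        refine convexHull_mono ?_ hf
        intro v hv
        obtain ⟨hv1, hv2⟩ := Finset.mem_filter.1 (Finset.mem_coe.1 hv)
        simp only [LinearMap.neg_apply, neg_inj, ContinuousLinearMap.coe_coe] at hv2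
        simp only [Finset.mem_insert] at hv1
        rcases hv1 with rfl | rfl | hv1
        · simp
        · simp
        · exact absurd hv2 (hgW v hv1).ne'
      have hT : Th X p x z := ⟨hxy.1, hzw.1, hn''.1.2.1, mem_openSegment_of_ne_left_right
        (by rintro rfl; exact hpX hxy.1) (by rintro rfl; exact hpX hzw.1) hseg⟩
      exact hn''.2.1.1 (hxy.share hX hT)
    have haW : a ∉ W := by simp [hW]
    have hbW : b ∉ W := by simp [hW]
    have hcW : c ∉ W := by simp [hW]
    have hdW : d ∉ W := by simp [hW]
    have hn'' : (a ≠ b ∧ a ≠ c ∧ a ≠ d) ∧ (b ≠ c ∧ b ≠ d) ∧ c ≠ d := by simpa using hn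
    rcases pick a b h1 with ga | gb <;> rcases pick c d h2 with gc | gd
    · exact key a b c d h1 h2 hn haW hcW ga gc
    · exact key a b d c h1 h2.symm (by simp; tauto) haW hdW ga gd
    · exact key b a c d h1.symm h2 (by simp; tauto) hbW hcW gb gc
    · exact key b a d c h1.symm h2.symm (by simp; tauto) hbW hdW gb gd
  have hdis : Disjoint ({a, b} : Finset E2) {c, d} := by
    simp at hn ⊢; tauto
  have hP := mk_partition (X := X) (S₁ := {a, b}) (S₂ := {c, d}) (S₃ := W) (y := p)
    (by
      rw [hW]; ext v
      simp only [Finset.mem_union, Finset.mem_sdiff, Finset.mem_insert, Finset.mem_singleton]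
      constructor
      · intro hv; tauto
      · rintro (((rfl | rfl) | (rfl | rfl)) | hv)
        exacts [h1.1, h1.2.1, h2.1, h2.2.1, hv.1])
    hdis
    (by
      rw [Finset.disjoint_left]; intro v hv hvW
      exact (Finset.mem_sdiff.1 hvW).2 (by simp at hv ⊢; tauto))
    (by
      rw [Finset.disjoint_left]; intro v hv hvW
      exact (Finset.mem_sdiff.1 hvW).2 (by simp at hv ⊢; tauto))
    (by rw [Finset.coe_pair, convexHull_pair]; exact hpab)
    (by rw [Finset.coe_pair, convexHull_pair]; exact hpcd) hpW
  refine ⟨_, hP.1, hP.2, ?_⟩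
  intro q hq
  simp only [Set.mem_iInter] at hq
  have q1 := hq {a, b} (by simp)
  have q2 := hq {c, d} (by simp)
  rw [Finset.coe_pair, convexHull_pair] at q1 q2
  have segD : ∀ x y : E2, q ∈ segment ℝ x y → D x y q = 0 := by
    rintro x y ⟨r, s, hr, hs, hrs, rfl⟩
    have hr' : r = 1 - s := by linarith
    subst hr'
    simp [D]; ring
  exact h1.unique hX h2 hn (segD _ _ q1) (segD _ _ q2)

/-- the seventh point lies on the inner side -/
lemma inner {X : Finset E2} (hX : GP X) {a b c d e f z p₁ p₂ p₃ : E2}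
    (hn : [a, b, c, d, e, f].Nodup) (hz : z ∈ X) (hzn : z ∉ [a, b, c, d, e, f])
    (h1 : Th X p₁ a b) (h2 : Th X p₁ c d) (h3 : Th X p₂ a b) (h4 : Th X p₂ e f)
    (hp3 : p₃ ∈ C X) (h12 : p₁ ≠ p₂) (h5 : D a b p₃ ≠ 0) : 0 < D p₁ p₂ p₃ * D p₁ p₂ z := by
  classical
  wlog hM : Maj X a b generalizing a b
  · refine this (a := b) (b := a) ?_ ?_ h1.symm h3.symm ?_ ?_
    · simp at hn ⊢; tauto
    · simp at hzn ⊢; tauto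
    · rw [D_swap12]; simpa using h5
    · exact (maj_or hX h1.1 h1.2.1 h1.2.2.1).resolve_left hM
  have hab := h1.2.2.1
  have hp : 0 < D a b p₃ := lt_of_le_of_ne (maj_nonneg hM hp3) h5.symm
  have hn' := hn
  simp only [List.nodup_cons, List.mem_cons, not_or, List.not_mem_nil, not_false_eq_true,
    and_true] at hn' hzn
  have hz0 : D a b z ≠ 0 := hX.coll a h1.1 b h1.2.1 z hz hab (by tauto) (by tauto)
  have neg : ∀ p x y, Th X p a b → Th X p x y → a ≠ x → b ≠ x → ∃ v, (v = x ∨ v = y) ∧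
      D a b v < 0 := by
    intro p x y hpab hpxy hax hbx
    by_contra hc
    push Not at hc
    have hx := hc x (Or.inl rfl)
    have hy := hc y (Or.inr rfl)
    obtain ⟨s, hs, hs1, hh⟩ := hpxy.D_comb a b
    rw [hpab.D_zero] at hh
    have := mul_nonneg hs.le hy
    have hx0 : 0 < D a b x :=
      lt_of_le_of_ne hx (Ne.symm (hX.coll a hpab.1 b hpab.2.1 x hpxy.1 hpab.2.2.1 hax hbx))
    have := mul_pos (show 0 < 1 - s by linarith) hx0
    linarith
  obtain ⟨v, hv, hvD⟩ := neg p₁ c d h1 h2 (by tauto) (by tauto)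
  obtain ⟨w, hw, hwD⟩ := neg p₂ e f h3 h4 (by tauto) (by tauto)
  have hvX : v ∈ X := by rcases hv with rfl | rfl; exacts [h2.1, h2.2.1]
  have hwX : w ∈ X := by rcases hw with rfl | rfl; exacts [h4.1, h4.2.1]
  have hvw : v ≠ w := by
    rcases hv with rfl | rfl <;> rcases hw with rfl | rfl <;> tauto
  have hzv : z ≠ v := by rcases hv with rfl | rfl <;> tauto
  have hzw : z ≠ w := by rcases hw with rfl | rfl <;> tauto
  have hzpos : 0 < D a b z := by
    by_contra hc
    have hzneg : D a b z < 0 := lt_of_le_of_ne (not_lt.1 hc) hz0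
    obtain ⟨S, hS, hS5, -, -, hSD⟩ := hM
    have hsub : S ⊆ X \ {z, v, w} := by
      intro x hx
      rw [Finset.mem_sdiff]
      refine ⟨hS hx, ?_⟩
      have := hSD x hx
      simp only [Finset.mem_insert, Finset.mem_singleton]
      rintro (rfl | rfl | rfl) <;> linarith
    have h6 := Finset.card_le_card hsub
    rw [Finset.card_sdiff_of_subset (by
      intro x hx; simp only [Finset.mem_insert, Finset.mem_singleton] at hx
      rcases hx with rfl | rfl | rfl <;> assumption), hX.card, hS5,
      Finset.card_eq_three.2 ⟨z, v, w, hzv, hzw, hvw, rfl⟩] at h6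
    omega
  obtain ⟨s, -, -, s0, s1⟩ := openSeg_param h1.2.2.2
  obtain ⟨r, -, -, r0, r1⟩ := openSeg_param h3.2.2.2
  have hrs : r - s ≠ 0 := by
    intro h
    have : r = s := by linarith
    subst this
    exact h12 (ext_coord (by rw [s0, r0]) (by rw [s1, r1]))
  have hD : ∀ x, D p₁ p₂ x = (r - s) * D a b x := by
    intro x; simp only [D, s0, s1, r0, r1]; ring
  rw [hD, hD]
  have : 0 < (r - s) ^ 2 * (D a b p₃ * D a b z) := by positivity
  linarith

lemma four_ext {X : Finset E2} (hX : GP X) (hCX : ∀ x ∈ C X, x ∉ X) :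
    ∃ p₁ ∈ Ext X, ∃ p₂ ∈ Ext X, ∃ p₃ ∈ Ext X, ∃ p₄ ∈ Ext X, [p₁, p₂, p₃, p₄].Nodup := by
  classical
  obtain ⟨p₁, hp₁⟩ : (Ext X).Nonempty := (C_compact hX).extremePoints_nonempty (C_nonempty hX)
  obtain ⟨a, b, h1ab⟩ := ext_some hX hp₁ (hCX _ hp₁.1)
  obtain ⟨c, d, -, h1cd, hn1⟩ := ext_other hX hp₁ (hCX _ hp₁.1) h1ab
  obtain ⟨p₂, hp₂, h21, h2ab⟩ := ext_adj hX hCX hp₁ h1ab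
  obtain ⟨p₃, hp₃, h31, h3cd⟩ := ext_adj hX hCX hp₁ h1cd
  have n2cd : D c d p₂ ≠ 0 := fun h => h21 (h1ab.unique hX h1cd hn1 h2ab.D_zero h)
  have n3ab : D a b p₃ ≠ 0 := fun h => h31 (h1ab.unique hX h1cd hn1 h h3cd.D_zero)
  have h23 : p₂ ≠ p₃ := by rintro rfl; exact n2cd h3cd.D_zero
  obtain ⟨e, f, -, h2ef, hn2⟩ := ext_other hX hp₂ (hCX _ hp₂.1) h2ab
  obtain ⟨p₄, hp₄, h42, h4ef⟩ := ext_adj hX hCX hp₂ h2ef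
  have n1ef : D e f p₁ ≠ 0 := fun h => h21 (h2ab.unique hX h2ef hn2 h1ab.D_zero h).symm
  have h41 : p₄ ≠ p₁ := by rintro rfl; exact n1ef h4ef.D_zero
  by_cases h43 : p₄ = p₃
  swap
  · exact ⟨p₁, hp₁, p₂, hp₂, p₃, hp₃, p₄, hp₄, by simp; tauto⟩
  exfalso
  subst h43
  have hn3 : [c, d, e, f].Nodup := by
    rcases h3cd.disj hX h4ef with h | ⟨rfl, rfl⟩ | ⟨rfl, rfl⟩
    · exact h
    · exact absurd h2ef.D_zero n2cd
    · exact absurd h2ef.symm.D_zero n2cd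
  have hn : [a, b, c, d, e, f].Nodup := by simp at hn1 hn2 hn3 ⊢; tauto
  obtain ⟨z, hz, hzn⟩ := Finset.exists_mem_notMem_of_card_lt_card
    (show [a, b, c, d, e, f].toFinset.card < X.card by
      rw [List.toFinset_card_of_nodup hn, hX.card]; simp)
  rw [List.mem_toFinset] at hzn
  have i1 := inner hX hn hz hzn h1ab h1cd h2ab h2ef hp₃.1 h21.symm n3ab
  have i2 := inner hX (a := c) (b := d) (c := a) (d := b) (e := e) (f := f) (p₁ := p₁) (p₂ := p₄)
    (p₃ := p₂) (by simp at hn ⊢; tauto) hz (by simp at hzn ⊢; tauto) h1cd h1ab h3cd h4ef hp₂.1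
    h31.symm n2cd
  have i3 := inner hX (a := e) (b := f) (c := a) (d := b) (e := c) (f := d) (p₁ := p₂) (p₂ := p₄)
    (p₃ := p₁) (by simp at hn ⊢; tauto) hz (by simp at hzn ⊢; tauto) h2ef h2ab h4ef h3cd hp₁.1
    h23 n1ef
  have e2 : D p₁ p₄ p₂ = - D p₁ p₂ p₄ := by simp only [D]; ring
  have e3 : D p₂ p₄ p₁ = D p₁ p₂ p₄ := by simp only [D]; ring
  rw [e2] at i2
  rw [e3] at i3
  have c1 : D z p₁ p₂ = D p₁ p₂ z := by simp only [D]; ring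
  have c2 : D z p₂ p₄ = D p₂ p₄ z := by simp only [D]; ring
  have c3 : D z p₄ p₁ = - D p₁ p₄ z := by simp only [D]; ring
  refine hCX z ?_ hz
  rcases lt_trichotomy (D p₁ p₂ p₄) 0 with hD | hD | hD
  · have j1 : D p₁ p₂ z < 0 := by
      by_contra hc; nlinarith [mul_nonneg (neg_nonneg.2 hD.le) (not_lt.1 hc)]
    have j2 : 0 < D p₁ p₄ z := by
      by_contra hc; nlinarith [mul_nonneg (neg_nonneg.2 hD.le) (neg_nonneg.2 (not_lt.1 hc))]
    have j3 : D p₂ p₄ z < 0 := by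
      by_contra hc; nlinarith [mul_nonneg (neg_nonneg.2 hD.le) (not_lt.1 hc)]
    refine mem_tri (C_convex X) hp₁.1 hp₃.1 hp₂.1 ?_ ?_ ?_ (by rw [e2]; linarith)
    · rw [D_swap, c3]; linarith
    · rw [D_swap, c2]; linarith
    · rw [D_swap, c1]; linarith
  · rw [hD] at i1; simp at i1
  · have j1 := pos_of_mul_pos_right i1 hD.le
    have j3 := pos_of_mul_pos_right i3 hD.le
    have j2 : D p₁ p₄ z < 0 := by
      by_contra hc; nlinarith [mul_nonneg hD.le (not_lt.1 hc)]
    refine mem_tri (C_convex X) hp₁.1 hp₂.1 hp₃.1 ?_ ?_ ?_ hD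
    · rw [c1]; exact j1.le
    · rw [c2]; exact j3.le
    · rw [c3]; linarith

end Tv

/-- Every set of 7 points in general position in the plane having only
Type II Tverberg partitions (no Tverberg point is one of the points of X)
has at least 4 Tverberg partitions into 3 parts. -/
theorem seven_points_only_typeII_at_least_four
    (X : Finset (EuclideanSpace ℝ (Fin 2))) (hcard : X.card = 7)
    (hgen : AlgebraicIndependent ℚ
      (fun p : {x // x ∈ X} × Fin 2 => (p.1 : EuclideanSpace ℝ (Fin 2)) p.2))
    (honlyII : ∀ P : Finset (Finset (EuclideanSpace ℝ (Fin 2))),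
      IsTverbergPartition 2 3 X P →
      ∀ y ∈ ⋂ S ∈ P, convexHull ℝ (S : Set (EuclideanSpace ℝ (Fin 2))), y ∉ X) :
    4 ≤ {P : Finset (Finset (EuclideanSpace ℝ (Fin 2))) |
      IsTverbergPartition 2 3 X P}.ncard := by
  classical
  have hX := Tv.GP.of_gen X hcard hgen
  have hCX : ∀ x ∈ Tv.C X, x ∉ X := by
    intro x hxC hx
    obtain ⟨P, hP, hxP⟩ := Tv.typeI hX hx hxC
    exact honlyII P hP x hxP hx
  obtain ⟨p₁, h₁, p₂, h₂, p₃, h₃, p₄, h₄, hn⟩ := Tv.four_ext hX hCX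
  obtain ⟨P₁, t₁, m₁, u₁⟩ := Tv.ext_tverberg hX hCX h₁
  obtain ⟨P₂, t₂, m₂, u₂⟩ := Tv.ext_tverberg hX hCX h₂
  obtain ⟨P₃, t₃, m₃, u₃⟩ := Tv.ext_tverberg hX hCX h₃
  obtain ⟨P₄, t₄, m₄, u₄⟩ := Tv.ext_tverberg hX hCX h₄
  have hn' : (p₁ ≠ p₂ ∧ p₁ ≠ p₃ ∧ p₁ ≠ p₄) ∧ (p₂ ≠ p₃ ∧ p₂ ≠ p₄) ∧ p₃ ≠ p₄ := by simpa using hn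
  have n12 : P₁ ≠ P₂ := by rintro rfl; exact hn'.1.1 (u₂ _ m₁)
  have n13 : P₁ ≠ P₃ := by rintro rfl; exact hn'.1.2.1 (u₃ _ m₁)
  have n14 : P₁ ≠ P₄ := by rintro rfl; exact hn'.1.2.2 (u₄ _ m₁)
  have n23 : P₂ ≠ P₃ := by rintro rfl; exact hn'.2.1.1 (u₃ _ m₂)
  have n24 : P₂ ≠ P₄ := by rintro rfl; exact hn'.2.1.2 (u₄ _ m₂)
  have n34 : P₃ ≠ P₄ := by rintro rfl; exact hn'.2.2 (u₄ _ m₃)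
  have hfin : {P : Finset (Finset (EuclideanSpace ℝ (Fin 2))) |
      IsTverbergPartition 2 3 X P}.Finite := by
    refine (X.powerset.powerset.finite_toSet).subset ?_
    intro P hP
    simp only [Finset.coe_powerset, Set.mem_preimage, Set.mem_powerset_iff]
    intro S hS
    simpa using hP.2.1 S hS
  have hsub : (({P₁, P₂, P₃, P₄} : Finset (Finset (Finset (EuclideanSpace ℝ (Fin 2))))) :
      Set (Finset (Finset (EuclideanSpace ℝ (Fin 2))))) ⊆
      {P | IsTverbergPartition 2 3 X P} := by
    intro P hP
    simp only [Finset.coe_insert, Finset.coe_singleton, Set.mem_insert_iff,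
      Set.mem_singleton_iff] at hP
    rcases hP with rfl | rfl | rfl | rfl <;> assumption
  have := Set.ncard_le_ncard hsub hfin
  rw [Set.ncard_coe_finset, Tv.card4 (by simp; tauto)] at this
  exact this
end
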